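/- Let (G, v₀) be a multiplayer quantitative reachability game, Γ = 2·|Π|·|V|, and d = Γ + 3·|V|, and let (t_i)_{i∈Π} ∈ (ℝ ∪ {+∞})^Π be a tuple of thresholds. Then there exists a secure equilibrium in (G, v₀) with cost profile (c_i)_{i∈Π} satisfying c_i ≤ t_i for all i ∈ Π if and only if there exists a goal-optimal and dev-optimal secure equilibrium in the truncated game 𝒯^d with cost profile (a_i)_{i∈Π} satisfying a_i ≤ t_i for all i ∈ Π. -/

import Mathlib

open scoped Classical ENat

/-- A multiplayer quantitative reachability game: a finite directed graph whose
vertices are partitioned among the players (via `owner`), every vertex has an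
outgoing edge, and each player `i` has a nonempty goal set `F i`. -/
structure QRGame (ι V : Type) where
  owner : V → ι
  E : V → V → Prop
  total : ∀ v, ∃ w, E v w
  F : ι → Set V
  F_ne : ∀ i, (F i).Nonempty

namespace QRGame

variable {ι V : Type}

/-- Histories are encoded as *reversed* nonempty lists: the head is the current
vertex, the last element is the initial vertex `v₀`, and consecutive elements
are joined by edges of the graph. -/
def IsHist (G : QRGame ι V) (v₀ : V) : List V → Prop
  | [] => False
  | [v] => v = v₀
  | v :: w :: t => G.E w v ∧ IsHist G v₀ (w :: t)

/-- The current (i.e. most recent) vertex of a history. -/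
def cur (v₀ : V) (h : List V) : V := h.headD v₀

/-- `σ` is a valid strategy of player `i`: on every history whose current
vertex belongs to player `i`, it chooses a successor along an edge. -/
def IsStrat (G : QRGame ι V) (v₀ : V) (i : ι) (σ : List V → V) : Prop :=
  ∀ h : List V, G.IsHist v₀ h → G.owner (cur v₀ h) = i → G.E (cur v₀ h) (σ h)

/-- A strategy profile: one valid strategy for each player. -/
def IsProfile (G : QRGame ι V) (v₀ : V) (σ : ι → List V → V) : Prop :=
  ∀ i, G.IsStrat v₀ i (σ i)

/-- The history reached after `n` further steps when all players follow the
profile `σ` from the history `h` on. -/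
def histFrom (G : QRGame ι V) (v₀ : V) (σ : ι → List V → V) (h : List V) : ℕ → List V
  | 0 => h
  | n + 1 =>
      σ (G.owner (cur v₀ (histFrom G v₀ σ h n))) (histFrom G v₀ σ h n)
        :: histFrom G v₀ σ h n

/-- The full play (indexed from time `0`) whose prefix is the history `h` and
which is consistent with the profile `σ` after `h`. -/
def fullPlay (G : QRGame ι V) (v₀ : V) (σ : ι → List V → V) (h : List V) (t : ℕ) : V :=
  (G.histFrom v₀ σ h t).reverse.getD t v₀

/-- The outcome `⟨(σ_i)⟩_{v₀}` of the profile `σ` from the initial vertex. -/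
def outcome (G : QRGame ι V) (v₀ : V) (σ : ι → List V → V) : ℕ → V :=
  G.fullPlay v₀ σ [v₀]

/-- Cost of player `i` for a play `ρ`: the least `l` with `ρ l ∈ F i`,
and `⊤` (i.e. `+∞`) if there is no such `l`. -/
noncomputable def cost (G : QRGame ι V) (i : ι) (ρ : ℕ → V) : ℕ∞ :=
  ⨅ l ∈ {l : ℕ | ρ l ∈ G.F i}, (l : ℕ∞)

/-- Cost of player `i` for the finite prefix `ρ₀ … ρ_{m-1}` of a play. -/
noncomputable def costLT (G : QRGame ι V) (i : ι) (ρ : ℕ → V) (m : ℕ) : ℕ∞ :=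
  ⨅ l ∈ {l : ℕ | l < m ∧ ρ l ∈ G.F i}, (l : ℕ∞)

end QRGame

/-- The preference relation `≺_j` of player `j` on cost profiles:
`x ≺_j y` iff `x j > y j`, or `x j = y j`, every player's cost does not
decrease, and some player's cost strictly increases. -/
def Prec {ι : Type} (j : ι) (x y : ι → ℕ∞) : Prop :=
  y j < x j ∨ (x j = y j ∧ (∀ i, x i ≤ y i) ∧ ∃ i, x i < y i)

namespace QRGame

variable {ι V : Type} [DecidableEq ι]

/-- `σ` restricted after the history `h` is a secure equilibrium in the subgame
`(G|_h, cur h)`: no player `j` has a `≺_j`-profitable deviation after `h`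
(costs are computed on the whole play, including the prefix `h`). -/
def IsSecureAfter (G : QRGame ι V) (v₀ : V) (σ : ι → List V → V) (h : List V) : Prop :=
  ¬ ∃ (j : ι) (σ' : List V → V), G.IsStrat v₀ j σ' ∧
      Prec j (fun i => G.cost i (G.fullPlay v₀ σ h))
        (fun i => G.cost i (G.fullPlay v₀ (Function.update σ j σ') h))

/-- A secure equilibrium in `(G, v₀)`. -/
def IsSecure (G : QRGame ι V) (v₀ : V) (σ : ι → List V → V) : Prop :=
  G.IsSecureAfter v₀ σ [v₀]

/-- A subgame perfect secure equilibrium: a secure equilibrium in every subgame. -/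
def IsSPSE (G : QRGame ι V) (v₀ : V) (σ : ι → List V → V) : Prop :=
  ∀ h : List V, G.IsHist v₀ h → G.IsSecureAfter v₀ σ h

end QRGame

namespace QRGame

variable {ι V : Type}

/-- `σ` is a valid strategy of player `i` in the truncated game `𝒯^d` played on
the truncation of the unraveling of `G` to depth `d`: it chooses a successor
along an edge on every history of length (number of edges) `< d`, i.e. on every
history whose list of vertices has length `≤ d`. -/
def IsStratTrunc (G : QRGame ι V) (v₀ : V) (d : ℕ) (i : ι) (σ : List V → V) : Prop :=
  ∀ h : List V, G.IsHist v₀ h → h.length ≤ d →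
    G.owner (cur v₀ h) = i → G.E (cur v₀ h) (σ h)

end QRGame

namespace QRGame

variable {ι V : Type} [DecidableEq ι]

/-- `σ` restricted after the history `h` is a secure equilibrium in the subgame
of the truncated game `𝒯^d` after `h`: costs are computed on the prefix of the
play of length `d` (vertices of indices `0, …, d`). -/
def IsSecureTruncAfter (G : QRGame ι V) (v₀ : V) (d : ℕ)
    (σ : ι → List V → V) (h : List V) : Prop :=
  ¬ ∃ (j : ι) (σ' : List V → V), G.IsStratTrunc v₀ d j σ' ∧
      Prec j (fun i => G.costLT i (G.fullPlay v₀ σ h) (d + 1))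
        (fun i => G.costLT i (G.fullPlay v₀ (Function.update σ j σ') h) (d + 1))

/-- A secure equilibrium in the truncated game `𝒯^d`. -/
def IsSecureTrunc (G : QRGame ι V) (v₀ : V) (d : ℕ) (σ : ι → List V → V) : Prop :=
  G.IsSecureTruncAfter v₀ d σ [v₀]

/-- A subgame perfect secure equilibrium in the truncated game `𝒯^d`: a secure
equilibrium in the subgame after every history of the truncated tree. -/
def IsSPSETrunc (G : QRGame ι V) (v₀ : V) (d : ℕ) (σ : ι → List V → V) : Prop :=
  ∀ h : List V, G.IsHist v₀ h → h.length ≤ d + 1 → G.IsSecureTruncAfter v₀ d σ h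

end QRGame

namespace QRGame

variable {ι V : Type} [Fintype V]

/-- Goal-optimality (with bound `Γ`) in the truncated game `𝒯^d`: costs are
computed on the outcome of the truncated game, i.e. on the prefix of length `d`. -/
noncomputable def GoalOptTrunc (G : QRGame ι V) (v₀ : V) (d : ℕ)
    (σ : ι → List V → V) (Γ : ℕ) : Prop :=
  ∀ i, G.costLT i (G.outcome v₀ σ) (d + 1) ≠ ⊤ →
    G.costLT i (G.outcome v₀ σ) (d + 1) < (Γ : ℕ∞)

/-- The bound `D = max{Cost_i(ρ) : Cost_i(ρ) < +∞} + |V|` attached to the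
outcome of a profile in the truncated game `𝒯^d`. -/
noncomputable def devBoundTrunc (G : QRGame ι V) (v₀ : V) (d : ℕ)
    (σ : ι → List V → V) : ℕ :=
  (⨆ i ∈ {i : ι | G.costLT i (G.outcome v₀ σ) (d + 1) ≠ ⊤},
      G.costLT i (G.outcome v₀ σ) (d + 1)).toNat + Fintype.card V

variable [DecidableEq ι]

/-- Dev-optimality of a secure equilibrium in the truncated game `𝒯^d`. -/
noncomputable def DevOptTrunc (G : QRGame ι V) (v₀ : V) (d : ℕ)
    (σ : ι → List V → V) : Prop :=
  ∀ (j : ι) (σ' : List V → V), G.IsStratTrunc v₀ d j σ' →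
    ¬ Prec j
        (fun i => G.costLT i (G.outcome v₀ σ) (G.devBoundTrunc v₀ d σ))
        (fun i => G.costLT i (G.outcome v₀ (Function.update σ j σ'))
          (G.devBoundTrunc v₀ d σ))

end QRGame

/-- The canonical embedding of `ℕ ∪ {+∞}` into `ℝ ∪ {+∞}`, used to compare
costs with real-valued thresholds. -/
noncomputable def enatToWithTopReal (x : ℕ∞) : WithTop ℝ :=
  if x = ⊤ then ⊤ else ((x.toNat : ℝ) : WithTop ℝ)

namespace QRGame

variable {ι V : Type}

/-- The reversed list `[π k, …, π 0]` of the first `k + 1` vertices of a sequence. -/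
def pre (π : ℕ → V) : ℕ → List V
  | 0 => [π 0]
  | k + 1 => π (k + 1) :: pre π k

@[simp] lemma length_pre (π : ℕ → V) (k : ℕ) : (pre π k).length = k + 1 := by
  induction k with
  | zero => rfl
  | succ k ih => simp [pre, ih]

@[simp] lemma cur_pre (v₀ : V) (π : ℕ → V) (k : ℕ) : cur v₀ (pre π k) = π k := by
  cases k <;> rfl

lemma pre_congr {π π' : ℕ → V} {k : ℕ} (h : ∀ m ≤ k, π m = π' m) : pre π k = pre π' k := by
  induction k with
  | zero => simp [pre, h 0 le_rfl]
  | succ k ih => simp [pre, h (k + 1) le_rfl, ih fun m hm => h m (by omega)]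

lemma getD_reverse_pre (v₀ : V) (π : ℕ → V) {k t : ℕ} (ht : t ≤ k) :
    (pre π k).reverse.getD t v₀ = π t := by
  induction k with
  | zero =>
    obtain rfl : t = 0 := by omega
    rfl
  | succ k ih =>
    rcases Nat.lt_or_ge k t with h | h
    · obtain rfl : t = k + 1 := by omega
      simp [pre]
    · rw [pre, List.reverse_cons, List.getD_append _ _ _ _ (by simp; omega), ih h]

/-- An infinite path of the game graph that starts in `v₀`. -/
def IsPlay (G : QRGame ι V) (v₀ : V) (π : ℕ → V) : Prop :=
  π 0 = v₀ ∧ ∀ k, G.E (π k) (π (k + 1))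

lemma isHist_pre {G : QRGame ι V} {v₀ : V} {π : ℕ → V} {k : ℕ} (h0 : π 0 = v₀)
    (hE : ∀ m < k, G.E (π m) (π (m + 1))) : G.IsHist v₀ (pre π k) := by
  induction k with
  | zero => exact h0
  | succ k ih =>
    have h1 := ih fun m hm => hE m (by omega)
    have h2 := hE k (by omega)
    cases k with
    | zero => exact ⟨h2, h1⟩
    | succ k => exact ⟨h2, h1⟩

/-- A choice function on histories that always moves along an edge. -/
def IsMove (G : QRGame ι V) (v₀ : V) (g : List V → V) : Prop :=
  ∀ h, G.E (cur v₀ h) (g h)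

/-- Replace the illegal choices of `f` by legal ones. -/
noncomputable def legalize (G : QRGame ι V) (v₀ : V) (f : List V → V) (h : List V) : V :=
  if G.E (cur v₀ h) (f h) then f h else (G.total (cur v₀ h)).choose

lemma isMove_legalize (G : QRGame ι V) (v₀ : V) (f : List V → V) :
    G.IsMove v₀ (G.legalize v₀ f) := by
  intro h
  unfold legalize
  split_ifs with hf
  · exact hf
  · exact (G.total (cur v₀ h)).choose_spec

lemma legalize_eq {G : QRGame ι V} {v₀ : V} {f : List V → V} {h : List V}
    (hf : G.E (cur v₀ h) (f h)) : G.legalize v₀ f h = f h := if_pos hf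

lemma exists_seq_of_step (g : List V → V) (x : V) :
    ∃ π : ℕ → V, π 0 = x ∧ ∀ m, π (m + 1) = g (pre π m) := by
  let H : ℕ → List V := fun n => Nat.rec [x] (fun _ h => g h :: h) n
  let π : ℕ → V := fun n => (H n).headD x
  have hH : ∀ n, pre π n = H n := by
    intro n
    induction n with
    | zero => rfl
    | succ n ih =>
      rw [pre, ih]
      rfl
  exact ⟨π, rfl, fun m => by rw [hH]; rfl⟩

/-- A play can be followed up to time `k` and continued by any legal choice function. -/
lemma IsPlay.exists_extend {G : QRGame ι V} {v₀ : V} {π : ℕ → V} (hπ : G.IsPlay v₀ π)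
    {g : List V → V} (hg : G.IsMove v₀ g) (k : ℕ) :
    ∃ π', G.IsPlay v₀ π' ∧ (∀ m ≤ k, π' m = π m) ∧ ∀ m, k ≤ m → π' (m + 1) = g (pre π' m) := by
  obtain ⟨π', h0, hs⟩ := exists_seq_of_step
    (fun h => if h.length ≤ k then π h.length else g h) (π 0)
  have hle : ∀ m ≤ k, π' m = π m := by
    intro m hm
    cases m with
    | zero => exact h0
    | succ m => rw [hs]; simp [hm]
  have hgt : ∀ m, k ≤ m → π' (m + 1) = g (pre π' m) := by
    intro m hm
    rw [hs, if_neg (by simp; omega)]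
  refine ⟨π', ⟨h0.trans hπ.1, fun m => ?_⟩, hle, hgt⟩
  rcases Nat.lt_or_ge m k with h | h
  · rw [hle m h.le, hle (m + 1) h]
    exact hπ.2 m
  · rw [hgt m h]
    simpa using hg (pre π' m)

/-- As `IsPlay.exists_extend`, with a prescribed legal move at time `k`. -/
lemma IsPlay.exists_extend_move {G : QRGame ι V} {v₀ : V} {π : ℕ → V} (hπ : G.IsPlay v₀ π)
    {g : List V → V} (hg : G.IsMove v₀ g) {k : ℕ} {w : V} (hw : G.E (π k) w) :
    ∃ π', G.IsPlay v₀ π' ∧ (∀ m ≤ k, π' m = π m) ∧ π' (k + 1) = w ∧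
      ∀ m, k < m → π' (m + 1) = g (pre π' m) := by
  obtain ⟨π', h1, h2, h3⟩ := hπ.exists_extend
    (G.isMove_legalize v₀ fun h => if h.length = k + 1 then w else g h) k
  refine ⟨π', h1, h2, ?_, fun m hm => ?_⟩
  · rw [h3 k le_rfl, legalize_eq]
    · simp
    · simpa [h2 k le_rfl] using hw
  · have : (pre π' m).length ≠ k + 1 := by simp; omega
    rw [h3 m hm.le, legalize_eq] <;> simp only [this, if_false]
    exact hg _

/-! ### Outcomes -/

lemma histFrom_eq_pre {G : QRGame ι V} {v₀ : V} {σ : ι → List V → V} {π : ℕ → V} {d : ℕ}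
    (h0 : π 0 = v₀) (hs : ∀ m < d, π (m + 1) = σ (G.owner (π m)) (pre π m)) :
    ∀ k ≤ d, G.histFrom v₀ σ [v₀] k = pre π k := by
  intro k hk
  induction k with
  | zero => simp [histFrom, pre, h0]
  | succ k ih => rw [histFrom, ih (by omega), cur_pre, pre, hs k (by omega)]

lemma outcome_eq_of_le {G : QRGame ι V} {v₀ : V} {σ : ι → List V → V} {π : ℕ → V} {d : ℕ}
    (h0 : π 0 = v₀) (hs : ∀ m < d, π (m + 1) = σ (G.owner (π m)) (pre π m)) :
    ∀ k ≤ d, G.outcome v₀ σ k = π k := by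
  intro k hk
  rw [outcome, fullPlay, histFrom_eq_pre h0 hs k hk, getD_reverse_pre _ _ le_rfl]

lemma outcome_eq {G : QRGame ι V} {v₀ : V} {σ : ι → List V → V} {π : ℕ → V}
    (h0 : π 0 = v₀) (hs : ∀ m, π (m + 1) = σ (G.owner (π m)) (pre π m)) :
    G.outcome v₀ σ = π :=
  funext fun k => outcome_eq_of_le (d := k) h0 (fun m _ => hs m) k le_rfl

@[simp] lemma outcome_zero (G : QRGame ι V) (v₀ : V) (σ : ι → List V → V) :
    G.outcome v₀ σ 0 = v₀ := rfl

lemma outcome_succ (G : QRGame ι V) (v₀ : V) (σ : ι → List V → V) (m : ℕ) :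
    G.outcome v₀ σ (m + 1) = σ (G.owner (G.outcome v₀ σ m)) (pre (G.outcome v₀ σ) m) := by
  obtain ⟨π, h0, hs⟩ := exists_seq_of_step (fun h => σ (G.owner (cur v₀ h)) h) v₀
  simp only [cur_pre] at hs
  rw [outcome_eq h0 hs]
  exact hs m

lemma IsPlay.outcome {G : QRGame ι V} {v₀ : V} {σ : ι → List V → V} (hσ : G.IsProfile v₀ σ) :
    G.IsPlay v₀ (G.outcome v₀ σ) := by
  refine ⟨rfl, fun k => ?_⟩
  induction k using Nat.strong_induction_on with
  | _ k ih =>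
    rw [outcome_succ]
    simpa using hσ _ (pre (G.outcome v₀ σ) k) (isHist_pre rfl ih) (by simp)

/-- The strategy that follows the play `π` as long as possible. -/
noncomputable def track (G : QRGame ι V) (v₀ : V) (π : ℕ → V) : List V → V :=
  G.legalize v₀ fun h => π h.length

lemma track_pre {G : QRGame ι V} {v₀ : V} {π : ℕ → V} (hπ : G.IsPlay v₀ π) (m : ℕ) :
    G.track v₀ π (pre π m) = π (m + 1) := by
  rw [track, legalize_eq] <;> simp [hπ.2 m]

section Deviations

variable [DecidableEq ι]

/-- In `π` all players other than `j` follow the profile `σ`. -/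
def IsConsistent (G : QRGame ι V) (σ : ι → List V → V) (j : ι) (π : ℕ → V) : Prop :=
  ∀ m, G.owner (π m) ≠ j → π (m + 1) = σ (G.owner (π m)) (pre π m)

lemma isConsistent_outcome_update (G : QRGame ι V) (v₀ : V) (σ : ι → List V → V) (j : ι)
    (σ' : List V → V) : G.IsConsistent σ j (G.outcome v₀ (Function.update σ j σ')) := by
  intro m hm
  rw [outcome_succ, Function.update_of_ne hm]

/-- Every play that is consistent with `σ` up to time `d`, except for player `j`, is up to
time `d` the outcome of a legal deviation of player `j`. -/
lemma IsPlay.exists_deviation {G : QRGame ι V} {v₀ : V} {σ : ι → List V → V} {j : ι}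
    {π : ℕ → V} (hπ : G.IsPlay v₀ π) :
    ∃ σ', (∀ h, G.E (cur v₀ h) (σ' h)) ∧
      ∀ d, (∀ m < d, G.owner (π m) ≠ j → π (m + 1) = σ (G.owner (π m)) (pre π m)) →
        ∀ k ≤ d, G.outcome v₀ (Function.update σ j σ') k = π k := by
  refine ⟨G.track v₀ π, G.isMove_legalize v₀ _, fun d hd => outcome_eq_of_le hπ.1 fun m hm => ?_⟩
  by_cases h : G.owner (π m) = j
  · rw [h, Function.update_self, track_pre hπ]
  · rw [Function.update_of_ne h]
    exact hd m hm h

lemma exists_isPlay_of_deviation_trunc {G : QRGame ι V} {v₀ : V} {σ : ι → List V → V} {j : ι}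
    (hσ : G.IsProfile v₀ σ) {d : ℕ} {σ' : List V → V} (hσ' : G.IsStratTrunc v₀ d j σ') :
    ∃ π, G.IsPlay v₀ π ∧ G.IsConsistent σ j π ∧
      ∀ k ≤ d, G.outcome v₀ (Function.update σ j σ') k = π k := by
  have hprof : G.IsProfile v₀ (Function.update σ j (G.legalize v₀ σ')) := by
    intro i
    by_cases h : i = j
    · subst h
      rw [Function.update_self]
      exact fun h _ _ => G.isMove_legalize v₀ _ h
    · rw [Function.update_of_ne h]
      exact hσ i
  have hplay := IsPlay.outcome hprof
  refine ⟨_, hplay, G.isConsistent_outcome_update v₀ σ j _,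
    outcome_eq_of_le hplay.1 fun m hm => ?_⟩
  rw [outcome_succ]
  by_cases h : G.owner (G.outcome v₀ (Function.update σ j (G.legalize v₀ σ')) m) = j
  · rw [h, Function.update_self, Function.update_self, legalize_eq]
    exact hσ' _ (isHist_pre hplay.1 fun m _ => hplay.2 m) (by simpa using hm) (by simpa using h)
  · rw [Function.update_of_ne h, Function.update_of_ne h]

end Deviations

/-- `π` is a play that first leaves the play `ρ` at time `l`, by moving to `v`, and all players
other than the deviating one follow the choice function `τ` from then on, up to time `k`. -/
def IsPunished (G : QRGame ι V) (v₀ : V) (ρ : ℕ → V) (l : ℕ) (v : V) (τ : List V → V) (k : ℕ)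
    (π : ℕ → V) : Prop :=
  G.IsPlay v₀ π ∧ (∀ m ≤ l, π m = ρ m) ∧ π (l + 1) = v ∧
    ∀ m, l < m → m < k → G.owner (π m) ≠ G.owner (ρ l) → π (m + 1) = τ (pre π m)

/-- After the deviation from `ρ` at time `l` to `v`, the other players can enforce `P`. -/
def CanEnforce (G : QRGame ι V) (v₀ : V) (ρ : ℕ → V) (l : ℕ) (v : V) (P : (ℕ → V) → Prop) :
    Prop :=
  ∃ τ, G.IsMove v₀ τ ∧ ∀ π, (∀ k, G.IsPunished v₀ ρ l v τ k π) → P π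

/-- Each deviation from the play `ρ` by some player `j` can be punished so that `P j` holds. -/
def Deterred (G : QRGame ι V) (v₀ : V) (ρ : ℕ → V) (P : ι → (ℕ → V) → Prop) : Prop :=
  ∀ l v, G.E (ρ l) v → v ≠ ρ (l + 1) → G.CanEnforce v₀ ρ l v (P (G.owner (ρ l)))

lemma Deterred.of_consistent {G : QRGame ι V} {v₀ : V} {σ : ι → List V → V}
    {P : ι → (ℕ → V) → Prop} (hσ : G.IsProfile v₀ σ)
    (h : ∀ j π, G.IsPlay v₀ π → G.IsConsistent σ j π → P j π) :
    G.Deterred v₀ (G.outcome v₀ σ) P := by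
  intro l v _ _
  refine ⟨G.legalize v₀ fun h => σ (G.owner (cur v₀ h)) h, G.isMove_legalize v₀ _, fun π hπ => ?_⟩
  obtain ⟨hplay, hle, -, -⟩ := hπ 0
  refine h _ π hplay fun m hm => ?_
  rcases lt_trichotomy m l with hml | rfl | hml
  · rw [hle (m + 1) hml, outcome_succ, hle m hml.le, pre_congr fun k hk => hle k (by omega)]
  · exact absurd (congrArg G.owner (hle m le_rfl)) hm
  · rw [(hπ (m + 1)).2.2.2 m hml (by omega) hm, legalize_eq] <;> rw [cur_pre]
    simpa using hσ _ (pre π m) (isHist_pre hplay.1 fun m _ => hplay.2 m) (by simp)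

lemma Deterred.exists_profile {G : QRGame ι V} {v₀ : V} {ρ : ℕ → V}
    {P : ι → (ℕ → V) → Prop} (hρ : G.IsPlay v₀ ρ) (hP : ∀ j, P j ρ)
    (h : G.Deterred v₀ ρ P) :
    ∃ σ, G.IsProfile v₀ σ ∧ G.outcome v₀ σ = ρ ∧
      ∀ j π, G.IsPlay v₀ π → G.IsConsistent σ j π → P j π := by
  have : Nonempty V := ⟨v₀⟩
  unfold Deterred CanEnforce at h
  choose! τ hτ hτP using h
  let left : List V → ℕ → Prop := fun h l =>
    l + 1 < h.length ∧ h.reverse.getD (l + 1) v₀ ≠ ρ (l + 1)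
  let s : List V → V := G.legalize v₀ fun h =>
    if H : ∃ l, left h l then τ (Nat.find H) (h.reverse.getD (Nat.find H + 1) v₀) h
    else ρ h.length
  have s_on : ∀ m, s (pre ρ m) = ρ (m + 1) := by
    intro m
    have hn : ¬ ∃ l, left (pre ρ m) l := by
      rintro ⟨l, hl, hne⟩
      rw [length_pre] at hl
      exact hne (getD_reverse_pre v₀ ρ (by omega))
    simp only [s]
    rw [legalize_eq] <;> simp only [dif_neg hn, length_pre]
    simpa using hρ.2 m
  have s_off : ∀ π l m, G.IsPlay v₀ π → (∀ k ≤ l, π k = ρ k) → π (l + 1) ≠ ρ (l + 1) → l < m →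
      s (pre π m) = τ l (π (l + 1)) (pre π m) := by
    intro π l m hπ hle hne hlm
    have H : ∃ l, left (pre π m) l :=
      ⟨l, by simp; omega, by rwa [getD_reverse_pre v₀ π (by omega)]⟩
    have hfind : Nat.find H = l := by
      rw [Nat.find_eq_iff]
      refine ⟨⟨by simp; omega, by rwa [getD_reverse_pre v₀ π (by omega)]⟩, ?_⟩
      rintro k hk ⟨-, hk2⟩
      rw [getD_reverse_pre v₀ π (by omega)] at hk2
      exact hk2 (hle _ (by omega))
    have hE : G.E (ρ l) (π (l + 1)) := hle l le_rfl ▸ hπ.2 l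
    simp only [s]
    rw [legalize_eq] <;>
      simp only [dif_pos H, hfind, getD_reverse_pre v₀ π (show l + 1 ≤ m by omega)]
    exact hτ l _ hE hne _
  have hs : G.IsMove v₀ s := G.isMove_legalize v₀ _
  refine ⟨fun _ => s, fun i h _ _ => hs h, outcome_eq hρ.1 fun m => (s_on m).symm,
    fun j π hπ hcons => ?_⟩
  by_cases heq : ∃ l, π (l + 1) ≠ ρ (l + 1)
  · obtain ⟨hne, hmin⟩ := Nat.find_spec heq, @Nat.find_min _ _ heq
    generalize Nat.find heq = l at hne hmin
    have hle : ∀ k ≤ l, π k = ρ k := by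
      intro k hk
      cases k with
      | zero => rw [hπ.1, hρ.1]
      | succ k => exact not_not.1 (hmin (by omega))
    have hj : G.owner (ρ l) = j := by
      by_contra hj
      apply hne
      rw [hcons l (by rwa [hle l le_rfl]), pre_congr hle]
      exact s_on l
    subst hj
    refine hτP l (π (l + 1)) (hle l le_rfl ▸ hπ.2 l) hne π fun k => ⟨hπ, hle, rfl, ?_⟩
    intro m hlm _ hm
    exact (hcons m hm).trans (s_off π l m hπ hle hne hlm)
  · push Not at heq
    have : π = ρ := by
      funext k
      cases k with
      | zero => rw [hπ.1, hρ.1]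
      | succ k => exact heq k
    exact this ▸ hP j

/-! ### Costs -/

lemma cost_lt_iff {G : QRGame ι V} {i : ι} {π : ℕ → V} {x : ℕ∞} :
    G.cost i π < x ↔ ∃ l : ℕ, (l : ℕ∞) < x ∧ π l ∈ G.F i := by
  simp only [cost, iInf_lt_iff, Set.mem_ofPred_eq]
  exact ⟨fun ⟨l, h, hl⟩ => ⟨l, hl, h⟩, fun ⟨l, hl, h⟩ => ⟨l, h, hl⟩⟩

lemma costLT_lt_iff {G : QRGame ι V} {i : ι} {π : ℕ → V} {m : ℕ} {x : ℕ∞} :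
    G.costLT i π m < x ↔ ∃ l : ℕ, l < m ∧ (l : ℕ∞) < x ∧ π l ∈ G.F i := by
  simp only [costLT, iInf_lt_iff, Set.mem_ofPred_eq]
  exact ⟨fun ⟨l, h, hl⟩ => ⟨l, h.1, hl, h.2⟩, fun ⟨l, hm, hl, h⟩ => ⟨l, ⟨hm, h⟩, hl⟩⟩

lemma cost_le {G : QRGame ι V} {i : ι} {π : ℕ → V} {l : ℕ} (h : π l ∈ G.F i) :
    G.cost i π ≤ l :=
  iInf₂_le (f := fun (l : ℕ) (_ : l ∈ {l | π l ∈ G.F i}) => (l : ℕ∞)) l h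

lemma le_cost_iff {G : QRGame ι V} {i : ι} {π : ℕ → V} {x : ℕ∞} :
    x ≤ G.cost i π ↔ ∀ l : ℕ, π l ∈ G.F i → x ≤ l := by
  simp [cost]

lemma mem_of_cost_eq {G : QRGame ι V} {i : ι} {π : ℕ → V} {x : ℕ} (h : G.cost i π = x) :
    π x ∈ G.F i := by
  obtain ⟨l, hl, hm⟩ := cost_lt_iff.1 (show G.cost i π < ((x + 1 : ℕ) : ℕ∞) by
    rw [h]; exact_mod_cast Nat.lt_succ_self x)
  have h1 := cost_le hm
  rw [h] at h1
  norm_cast at h1 hl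
  obtain rfl : l = x := by omega
  exact hm

lemma cost_eq_top_iff {G : QRGame ι V} {i : ι} {π : ℕ → V} :
    G.cost i π = ⊤ ↔ ∀ l, π l ∉ G.F i := by
  rw [← top_le_iff, le_cost_iff]
  simp

lemma cost_eq_coe_iff {G : QRGame ι V} {i : ι} {π : ℕ → V} {x : ℕ} :
    G.cost i π = x ↔ π x ∈ G.F i ∧ ∀ l < x, π l ∉ G.F i := by
  constructor
  · refine fun h => ⟨mem_of_cost_eq h, fun l hl hm => ?_⟩
    have := cost_le hm
    rw [h] at this
    norm_cast at this
    omega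
  · rintro ⟨h1, h2⟩
    refine le_antisymm (cost_le h1) (le_cost_iff.2 fun l hl => ?_)
    have : ¬ l < x := fun h => h2 l h hl
    exact_mod_cast not_lt.1 this

lemma exists_cost_eq {G : QRGame ι V} {i : ι} {π : ℕ → V} (h : G.cost i π ≠ ⊤) :
    ∃ x : ℕ, G.cost i π = x := ⟨_, (ENat.natCast_toNat h).symm⟩

lemma cost_eq_of_agree {G : QRGame ι V} {i : ι} {π π' : ℕ → V} {s : ℕ}
    (h : ∀ m ≤ s, π m = π' m) (hs : G.cost i π ≤ s) : G.cost i π' = G.cost i π := by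
  obtain ⟨x, hx⟩ := exists_cost_eq (ne_top_of_le_ne_top (ENat.natCast_ne_top s) hs)
  rw [hx] at hs
  norm_cast at hs
  rw [hx, cost_eq_coe_iff, ← h x hs]
  rw [cost_eq_coe_iff] at hx
  refine ⟨hx.1, fun l hl => ?_⟩
  rw [← h l (by omega)]
  exact hx.2 l hl

lemma cost_le_costLT (G : QRGame ι V) (i : ι) (π : ℕ → V) (m : ℕ) :
    G.cost i π ≤ G.costLT i π m := by
  by_contra! h
  obtain ⟨l, -, hl, hF⟩ := costLT_lt_iff.1 h
  exact (cost_le hF).not_gt hl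

lemma costLT_eq_cost {G : QRGame ι V} {i : ι} {π : ℕ → V} {m : ℕ} (h : G.cost i π < m) :
    G.costLT i π m = G.cost i π := by
  refine le_antisymm ?_ (cost_le_costLT G i π m)
  by_contra! h'
  obtain ⟨x, hx⟩ := exists_cost_eq h.ne_top
  rw [hx] at h h'
  exact lt_irrefl (G.costLT i π m)
    ((costLT_lt_iff.2 ⟨x, by exact_mod_cast h, h', mem_of_cost_eq hx⟩))

lemma costLT_eq_top {G : QRGame ι V} {i : ι} {π : ℕ → V} {m : ℕ} (h : (m : ℕ∞) ≤ G.cost i π) :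
    G.costLT i π m = ⊤ := by
  by_contra h'
  obtain ⟨l, hl, -, hF⟩ := costLT_lt_iff.1 (lt_top_iff_ne_top.2 h')
  exact absurd (h.trans (cost_le hF)) (by exact_mod_cast hl.not_ge)

lemma cost_eq_of_costLT_ne_top {G : QRGame ι V} {i : ι} {π : ℕ → V} {m : ℕ}
    (h : G.costLT i π m ≠ ⊤) : G.cost i π = G.costLT i π m := by
  rcases lt_or_ge (G.cost i π) (m : ℕ∞) with h1 | h1
  · exact (costLT_eq_cost h1).symm
  · exact absurd (costLT_eq_top h1) h

lemma notMem_of_costLT_eq_top {G : QRGame ι V} {i : ι} {π : ℕ → V} {m l : ℕ}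
    (h : G.costLT i π m = ⊤) (hl : l < m) : π l ∉ G.F i := fun hF =>
  (costLT_lt_iff.2 ⟨l, hl, ENat.natCast_lt_top l, hF⟩).ne h

lemma costLT_congr {G : QRGame ι V} {i : ι} {π π' : ℕ → V} {m : ℕ}
    (h : ∀ l < m, π l = π' l) : G.costLT i π m = G.costLT i π' m := by
  have : {l : ℕ | l < m ∧ π l ∈ G.F i} = {l : ℕ | l < m ∧ π' l ∈ G.F i} :=
    Set.ext fun l => and_congr_right fun hl => by rw [h l hl]
  rw [costLT, costLT, this]

/-! ### Attractors -/

/-- The vertices in `U` from which `T` can be forced within `k` steps when the vertices in `C` are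
controlled by the attacker. -/
def attr (G : QRGame ι V) (C U T : Set V) : ℕ → Set V
  | 0 => T
  | k + 1 => T ∪ {v | v ∈ U ∧ (v ∈ C → ∃ w, G.E v w ∧ w ∈ attr G C U T k) ∧
      (v ∉ C → ∀ w, G.E v w → w ∈ attr G C U T k)}

lemma subset_attr (G : QRGame ι V) (C U T : Set V) (k : ℕ) : T ⊆ G.attr C U T k := by
  cases k with
  | zero => exact subset_rfl
  | succ k => exact Set.subset_union_left

lemma attr_mono (G : QRGame ι V) (C U T : Set V) : Monotone (G.attr C U T) := by
  refine monotone_nat_of_le_succ fun k => ?_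
  induction k with
  | zero => exact G.subset_attr C U T 1
  | succ k ih =>
    rintro v (hv | ⟨h1, h2, h3⟩)
    · exact Or.inl hv
    · refine Or.inr ⟨h1, fun hC => ?_, fun hC w hw => ih (h3 hC w hw)⟩
      obtain ⟨w, hw, hk⟩ := h2 hC
      exact ⟨w, hw, ih hk⟩

lemma attr_succ_congr {G : QRGame ι V} {C U T : Set V} {k l : ℕ}
    (h : G.attr C U T k = G.attr C U T l) : G.attr C U T (k + 1) = G.attr C U T (l + 1) := by
  simp only [attr, h]

lemma attr_empty (G : QRGame ι V) (C U : Set V) (k : ℕ) : G.attr C U ∅ k = ∅ := by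
  induction k with
  | zero => rfl
  | succ k ih =>
    rw [Set.eq_empty_iff_forall_notMem]
    rintro v (hv | ⟨-, h2, h3⟩)
    · exact hv
    · rw [ih] at h2 h3
      obtain ⟨w, hw⟩ := G.total v
      by_cases hC : v ∈ C
      · obtain ⟨w, -, hw⟩ := h2 hC
        exact hw
      · exact h3 hC w hw

/-- The attractor is reached after `|V| - 1` steps. -/
lemma attr_stable [Fintype V] (G : QRGame ι V) (C U T : Set V) :
    G.attr C U T (Fintype.card V - 1 + 1) = G.attr C U T (Fintype.card V - 1) := by
  rcases T.eq_empty_or_nonempty with rfl | hT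
  · simp only [attr_empty]
  have key : ∀ k, k + 1 ≤ (G.attr C U T k).ncard ∨
      G.attr C U T (k + 1) = G.attr C U T k := by
    intro k
    induction k with
    | zero => exact Or.inl (hT.ncard_pos (Set.toFinite _))
    | succ k ih =>
      rcases ih with ih | ih
      · by_cases heq : G.attr C U T (k + 1) = G.attr C U T k
        · exact Or.inr (attr_succ_congr heq)
        · have := Set.ncard_lt_ncard
            ((G.attr_mono C U T (Nat.le_add_right k 1)).ssubset_of_ne (Ne.symm heq))
            (Set.toFinite _)
          exact Or.inl (by omega)
      · exact Or.inr (attr_succ_congr ih)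
  by_contra hne
  have hk := (key (Fintype.card V - 1)).resolve_right hne
  have hlt := Set.ncard_lt_ncard
    ((G.attr_mono C U T (Nat.le_add_right _ 1)).ssubset_of_ne (Ne.symm hne))
    (Set.toFinite _)
  have hle : (G.attr C U T (Fintype.card V - 1 + 1)).ncard ≤ Fintype.card V := by
    rw [← Nat.card_eq_fintype_card]
    exact Set.ncard_le_card _
  omega

/-- Outside the attractor, the attacker cannot enter it, and the opponent can avoid it. -/
lemma notMem_attr [Fintype V] {G : QRGame ι V} {C U T : Set V} {v : V} (hU : v ∈ U)
    (hv : v ∉ G.attr C U T (Fintype.card V - 1)) :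
    (v ∈ C → ∀ w, G.E v w → w ∉ G.attr C U T (Fintype.card V - 1)) ∧
      (v ∉ C → ∃ w, G.E v w ∧ w ∉ G.attr C U T (Fintype.card V - 1)) := by
  rw [← attr_stable] at hv
  have hv' : ¬ (v ∈ U ∧ (v ∈ C → ∃ w, G.E v w ∧ w ∈ G.attr C U T (Fintype.card V - 1)) ∧
      (v ∉ C → ∀ w, G.E v w → w ∈ G.attr C U T (Fintype.card V - 1))) := fun h => hv (Or.inr h)
  by_cases hC : v ∈ C
  · refine ⟨fun _ w hw hA => hv' ⟨hU, fun _ => ⟨w, hw, hA⟩, fun h => absurd hC h⟩,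
      fun h => absurd hC h⟩
  · refine ⟨fun h => absurd h hC, fun _ => ?_⟩
    by_contra! h
    exact hv' ⟨hU, fun h => absurd h hC, fun _ => h⟩

/-- A positional strategy for the attacker that decreases the distance to `T`, and stays in a
given set where this is possible. -/
lemma exists_attr_move (G : QRGame ι V) (C U T : Set V) (hTU : T ⊆ U)
    (hU : ∀ v ∈ U, v ∈ C → ∃ w, G.E v w ∧ w ∈ U) :
    ∃ p : V → V, (∀ v, G.E v (p v)) ∧ (∀ v ∈ U, v ∈ C → p v ∈ U) ∧
      ∀ k, ∀ v ∈ G.attr C U T (k + 1), v ∈ C → v ∈ T ∨ p v ∈ G.attr C U T k := by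
  have hAU : ∀ k, G.attr C U T k ⊆ U := by
    intro k
    cases k with
    | zero => exact hTU
    | succ k => exact Set.union_subset hTU fun v hv => hv.1
  suffices h : ∀ v, ∃ w, G.E v w ∧ (v ∈ U → v ∈ C → w ∈ U) ∧
      ∀ k, v ∈ G.attr C U T (k + 1) → v ∈ C → v ∈ T ∨ w ∈ G.attr C U T k by
    choose p hp using h
    exact ⟨p, fun v => (hp v).1, fun v => (hp v).2.1, fun k v => (hp v).2.2 k⟩
  intro v
  by_cases hC : v ∈ C
  · by_cases hA : v ∉ T ∧ ∃ k, v ∈ G.attr C U T (k + 1)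
    · obtain ⟨hT, hA⟩ := hA
      obtain ⟨hk, hmin⟩ := Nat.find_spec hA, @Nat.find_min' _ _ hA
      generalize Nat.find hA = k at hk hmin
      rcases hk with hk | ⟨-, hk, -⟩
      · exact absurd hk hT
      · obtain ⟨w, hw, hwk⟩ := hk hC
        exact ⟨w, hw, fun _ _ => hAU k hwk,
          fun l hl _ => Or.inr (G.attr_mono C U T (hmin hl) hwk)⟩
    · have hT : ∀ k, v ∈ G.attr C U T (k + 1) → v ∈ T := by
        intro k hk
        by_contra hT
        exact hA ⟨hT, k, hk⟩
      by_cases hvU : v ∈ U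
      · obtain ⟨w, hw, hwU⟩ := hU v hvU hC
        exact ⟨w, hw, fun _ _ => hwU, fun k hk _ => Or.inl (hT k hk)⟩
      · obtain ⟨w, hw⟩ := G.total v
        exact ⟨w, hw, fun h => absurd h hvU, fun k hk _ => Or.inl (hT k hk)⟩
  · obtain ⟨w, hw⟩ := G.total v
    exact ⟨w, hw, fun _ h => absurd h hC, fun _ _ h => absurd h hC⟩

/-- Following such a strategy from time `s` on, the attacker reaches `T` in time. -/
lemma exists_mem_of_attr {G : QRGame ι V} {C U T : Set V} {p : V → V} {π : ℕ → V} {s : ℕ}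
    (hp : ∀ k, ∀ v ∈ G.attr C U T (k + 1), v ∈ C → v ∈ T ∨ p v ∈ G.attr C U T k)
    (hE : ∀ m, G.E (π m) (π (m + 1)))
    (hπ : ∀ m, s ≤ m → π m ∈ C → π (m + 1) = p (π m)) {k : ℕ}
    (hk : π s ∈ G.attr C U T k) : ∃ m, s ≤ m ∧ m ≤ s + k ∧ π m ∈ T := by
  induction k generalizing s with
  | zero => exact ⟨s, le_rfl, le_rfl, hk⟩
  | succ k ih =>
    by_cases hT : π s ∈ T
    · exact ⟨s, le_rfl, by omega, hT⟩
    · have : π (s + 1) ∈ G.attr C U T k := by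
        by_cases hC : π s ∈ C
        · rw [hπ s le_rfl hC]
          exact (hp k _ hk hC).resolve_left hT
        · exact (hk.resolve_left hT).2.2 hC _ (hE s)
      obtain ⟨m, h1, h2, h3⟩ := ih (fun m hm => hπ m (by omega)) this
      exact ⟨m, by omega, by omega, h3⟩

/-! ### Accelerating punishments -/

lemma IsPunished.congr {G : QRGame ι V} {v₀ v : V} {ρ π π' : ℕ → V} {l k : ℕ} {τ : List V → V}
    (h : G.IsPunished v₀ ρ l v τ k π) (hlk : l < k) (hπ' : G.IsPlay v₀ π')
    (hle : ∀ m ≤ k, π' m = π m) : G.IsPunished v₀ ρ l v τ k π' := by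
  refine ⟨hπ', fun m hm => (hle m (by omega)).trans (h.2.1 m hm),
    (hle _ (by omega)).trans h.2.2.1, fun m h1 h2 h3 => ?_⟩
  rw [hle m h2.le] at h3
  rw [hle (m + 1) h2, h.2.2.2 m h1 h2 h3, pre_congr fun i hi => hle i (by omega)]

lemma IsPunished.of_le {G : QRGame ι V} {v₀ v : V} {ρ π : ℕ → V} {l k : ℕ} {τ : List V → V}
    (h : G.IsPunished v₀ ρ l v τ k π)
    (hge : ∀ m, k ≤ m → G.owner (π m) ≠ G.owner (ρ l) → π (m + 1) = τ (pre π m)) (k' : ℕ) :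
    G.IsPunished v₀ ρ l v τ k' π := by
  refine ⟨h.1, h.2.1, h.2.2.1, fun m h1 _ h3 => ?_⟩
  rcases Nat.lt_or_ge m k with hm | hm
  · exact h.2.2.2 m h1 hm h3
  · exact hge m hm h3

lemma IsPunished.exists_complete {G : QRGame ι V} {v₀ v : V} {ρ π : ℕ → V} {l k : ℕ}
    {τ : List V → V} (h : G.IsPunished v₀ ρ l v τ k π) (hlk : l < k) (hτ : G.IsMove v₀ τ) :
    ∃ π', (∀ k', G.IsPunished v₀ ρ l v τ k' π') ∧ ∀ m ≤ k, π' m = π m := by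
  obtain ⟨π', h1, h2, h3⟩ := h.1.exists_extend hτ k
  exact ⟨π', (h.congr hlk h1 h2).of_le fun m hm _ => h3 m hm, h2⟩

/-- The vertices that can be visited while the deviation from `ρ` to `v` at time `l` is
punished according to `τ`. -/
def punishSet (G : QRGame ι V) (v₀ : V) (ρ : ℕ → V) (l : ℕ) (v : V) (τ : List V → V) : Set V :=
  {x | ∃ π k, l < k ∧ G.IsPunished v₀ ρ l v τ k π ∧ π k = x}

lemma mem_punishSet_of_owner_eq {G : QRGame ι V} {v₀ v : V} {ρ : ℕ → V} {l : ℕ} {τ : List V → V}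
    (hτ : G.IsMove v₀ τ) {x w : V} (hx : x ∈ G.punishSet v₀ ρ l v τ)
    (hj : G.owner x = G.owner (ρ l)) (hw : G.E x w) : w ∈ G.punishSet v₀ ρ l v τ := by
  obtain ⟨π, k, hlk, hπ, rfl⟩ := hx
  obtain ⟨π', h1, h2, h3, -⟩ := hπ.1.exists_extend_move hτ hw
  refine ⟨π', k + 1, by omega, ⟨h1, fun m hm => ?_, ?_, fun m hm hmk ho => ?_⟩, h3⟩
  · rw [h2 m (by omega), hπ.2.1 m hm]
  · rw [h2 _ (by omega), hπ.2.2.1]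
  · rcases Nat.lt_or_ge m k with hm' | hm'
    · exact (hπ.congr hlk h1 h2).2.2.2 m hm hm' ho
    · obtain rfl : m = k := by omega
      exact absurd (by rw [h2 m le_rfl, hj]) ho

lemma exists_mem_punishSet {G : QRGame ι V} {v₀ v : V} {ρ : ℕ → V} {l : ℕ} {τ : List V → V}
    (hτ : G.IsMove v₀ τ) {x : V} (hx : x ∈ G.punishSet v₀ ρ l v τ) :
    ∃ w, G.E x w ∧ w ∈ G.punishSet v₀ ρ l v τ := by
  obtain ⟨π, k, hlk, hπ, rfl⟩ := hx
  obtain ⟨π', h1, h2⟩ := hπ.exists_complete hlk hτ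
  refine ⟨π' (k + 1), ?_, π', k + 1, by omega, h1 _, rfl⟩
  rw [← h2 k le_rfl]
  exact (h1 0).1.2 k

/-- The cost profile `c'` of a punished deviation of player `j` from a play with cost profile `c`:
player `j` does not gain, and, if he does not lose, then either a player who has been served by
time `s` is served earlier, or another one is served before time `s + N`, or nothing changes for
the players served by time `s` and no other player is ever served. -/
def SettledBy (c c' : ι → ℕ∞) (j : ι) (s N : ℕ) : Prop :=
  c j ≤ c' j ∧ (c j < c' j ∨ (∃ i, c i ≤ s ∧ c' i < c i) ∨ (∃ i, s < c i ∧ c' i < (s + N : ℕ)) ∨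
    ((∀ i, c i ≤ s → c' i = c i) ∧ ∀ i, c i ≤ s ∨ c i = ⊤))

/-- If a deviation by `j` at time `l < s` can be punished, then it can be punished in such a way
that the punishment takes effect before time `s + |V|`. -/
lemma CanEnforce.accelerate [Fintype V] {G : QRGame ι V} {v₀ v : V} {ρ : ℕ → V} {l s : ℕ}
    {j : ι} (hjl : G.owner (ρ l) = j) (hls : l < s)
    (hj : G.cost j ρ ≤ s ∨ G.cost j ρ = ⊤)
    (h : G.CanEnforce v₀ ρ l v fun π => ¬ Prec j (fun i => G.cost i ρ) fun i => G.cost i π) :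
    G.CanEnforce v₀ ρ l v fun π =>
      SettledBy (fun i => G.cost i ρ) (fun i => G.cost i π) j s (Fintype.card V) := by
  subst hjl
  obtain ⟨τ, hτ, hP⟩ := h
  set j := G.owner (ρ l) with hjdef
  set S := G.punishSet v₀ ρ l v τ with hS
  let C : Set V := {x | G.owner x ≠ j}
  let T : Set V := {x | x ∈ S ∧ ∃ i, s < G.cost i ρ ∧ x ∈ G.F i}
  set A := G.attr C S T (Fintype.card V - 1) with hA
  have hV : 0 < Fintype.card V := Fintype.card_pos_iff.2 ⟨v₀⟩
  have hnotgain : ∀ π, (∀ k, G.IsPunished v₀ ρ l v τ k π) → G.cost j ρ ≤ G.cost j π := by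
    intro π hπ
    by_contra! hlt
    exact hP π hπ (Or.inl hlt)
  have hSj : G.cost j ρ = ⊤ → ∀ x ∈ S, x ∉ G.F j := by
    rintro htop _ ⟨π, k, hlk, hπ, rfl⟩
    obtain ⟨π', h1, h2⟩ := hπ.exists_complete hlk hτ
    have h3 := hnotgain π' h1
    rw [htop, top_le_iff, cost_eq_top_iff] at h3
    rw [← h2 k le_rfl]
    exact h3 k
  obtain ⟨p, hpE, hpS, hpA⟩ := G.exists_attr_move C S T (fun x hx => hx.1)
    fun x hx _ => exists_mem_punishSet hτ hx
  refine ⟨fun h => if h.length ≤ s then τ h else p (cur v₀ h), fun h => ?_, fun π hπ => ?_⟩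
  · dsimp only
    split_ifs
    · exact hτ h
    · exact hpE _
  have hplay := (hπ 0).1
  have hπτ : G.IsPunished v₀ ρ l v τ s π := by
    refine ⟨hplay, (hπ 0).2.1, (hπ 0).2.2.1, fun m h1 h2 h3 => ?_⟩
    exact ((hπ s).2.2.2 m h1 h2 h3).trans (if_pos (by simpa using h2))
  have hπp : ∀ m, s ≤ m → π m ∈ C → π (m + 1) = p (π m) := by
    intro m h1 h2
    rw [(hπ (m + 1)).2.2.2 m (by omega) (by omega) h2, ← cur_pre v₀ π m]
    exact if_neg (by simp; omega)
  have hπS : ∀ m, s ≤ m → π m ∈ S := by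
    intro m hm
    induction m, hm using Nat.le_induction with
    | base => exact ⟨π, s, hls, hπτ, rfl⟩
    | succ m hm ih =>
      by_cases hC : π m ∈ C
      · rw [hπp m hm hC]
        exact hpS _ ih hC
      · exact mem_punishSet_of_owner_eq hτ ih (not_not.1 hC) (hplay.2 m)
  have hgain : G.cost j ρ ≤ G.cost j π := by
    obtain ⟨π', h1, h2⟩ := hπτ.exists_complete hls hτ
    rw [le_cost_iff]
    intro k hk
    have h3 := le_cost_iff.1 (hnotgain π' h1) k
    rcases le_total k s with hks | hks
    · exact h3 (by rwa [h2 k hks])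
    · rcases hj with hj | hj
      · exact hj.trans (by exact_mod_cast hks)
      · exact absurd hk (hSj hj _ (hπS k hks))
  refine ⟨hgain, ?_⟩
  by_cases hsA : π s ∈ A
  · obtain ⟨m, -, h2, -, i, hi, hm⟩ := exists_mem_of_attr hpA hplay.2 hπp hsA
    refine Or.inr (Or.inr (Or.inl ⟨i, hi, (cost_le hm).trans_lt ?_⟩))
    exact_mod_cast (by omega : m < s + Fintype.card V)
  -- the deviating player can avoid `T` against the original punishment
  have hq : ∃ q : V → V, (∀ x, G.E x (q x)) ∧ ∀ x ∈ S, x ∉ A → x ∉ C → q x ∉ A := by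
    suffices h : ∀ x, ∃ w, G.E x w ∧ (x ∈ S → x ∉ A → x ∉ C → w ∉ A) by
      choose q hq using h
      exact ⟨q, fun x => (hq x).1, fun x => (hq x).2⟩
    intro x
    by_cases hx : x ∈ S ∧ x ∉ A ∧ x ∉ C
    · obtain ⟨w, h1, h2⟩ := (notMem_attr hx.1 hx.2.1).2 hx.2.2
      exact ⟨w, h1, fun _ _ _ => h2⟩
    · obtain ⟨w, hw⟩ := G.total x
      exact ⟨w, hw, fun h1 h2 h3 => absurd ⟨h1, h2, h3⟩ hx⟩
  obtain ⟨q, hqE, hqA⟩ := hq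
  obtain ⟨π', h1, h2, h3⟩ := hplay.exists_extend
    (g := fun h => if cur v₀ h ∈ C then τ h else q (cur v₀ h)) (fun h => by
      dsimp only
      split_ifs
      · exact hτ h
      · exact hqE _) s
  have h4 : ∀ k, G.IsPunished v₀ ρ l v τ k π' := by
    refine (hπτ.congr hls h1 h2).of_le fun m hm ho => ?_
    rw [h3 m hm, if_pos (by rw [cur_pre]; exact ho)]
  have hS' : ∀ m, s ≤ m → π' m ∈ S := fun m hm => ⟨π', m, by omega, h4 m, rfl⟩
  have hA' : ∀ m, s ≤ m → π' m ∉ A := by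
    intro m hm
    induction m, hm using Nat.le_induction with
    | base => rwa [h2 s le_rfl]
    | succ m hm ih =>
      by_cases hC : π' m ∈ C
      · exact (notMem_attr (hS' m hm) ih).1 hC _ (h1.2 m)
      · rw [h3 m hm, cur_pre, if_neg hC]
        exact hqA _ (hS' m hm) ih hC
  have hF' : ∀ i, s < G.cost i ρ → ∀ m, s ≤ m → π' m ∉ G.F i := fun i hi m hm hF =>
    hA' m hm (G.subset_attr C S T _ ⟨hS' m hm, i, hi, hF⟩)
  by_cases hlt : G.cost j ρ < G.cost j π
  · exact Or.inl hlt
  have hjeq : G.cost j ρ = G.cost j π := le_antisymm hgain (not_lt.1 hlt)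
  have hjeq' : G.cost j ρ = G.cost j π' := by
    rcases hj with hj | hj
    · rw [hjeq, cost_eq_of_agree (fun m hm => (h2 m hm).symm) (hjeq ▸ hj)]
    · have := hnotgain π' h4
      rw [hj, top_le_iff] at this
      rw [hj, this]
  have hprec := hP π' h4
  by_cases hlow : ∃ i, G.cost i π' < G.cost i ρ
  · obtain ⟨i, hi⟩ := hlow
    obtain ⟨x, hx⟩ := exists_cost_eq hi.ne_top
    have hxm := mem_of_cost_eq hx
    by_cases his : G.cost i ρ ≤ s
    · refine Or.inr (Or.inl ⟨i, his, ?_⟩)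
      dsimp only
      rwa [cost_eq_of_agree h2 (hi.le.trans his)]
    · rw [not_le] at his
      refine Or.inr (Or.inr (Or.inl ⟨i, his, ?_⟩))
      have hxs : x < s := by
        by_contra! hsx
        exact hF' i his x hsx hxm
      rw [h2 x hxs.le] at hxm
      exact (cost_le hxm).trans_lt (by exact_mod_cast (by omega : x < s + Fintype.card V))
  · push Not at hlow
    have heq : ∀ i, G.cost i ρ = G.cost i π' := by
      intro i
      refine (hlow i).eq_of_not_lt fun hi => ?_
      exact hprec (Or.inr ⟨hjeq', hlow, i, hi⟩)
    refine Or.inr (Or.inr (Or.inr ⟨fun i hi => ?_, fun i => ?_⟩))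
    · dsimp only at hi ⊢
      rw [cost_eq_of_agree h2 (heq i ▸ hi), heq i]
    · by_contra! hi
      obtain ⟨x, hx⟩ := exists_cost_eq hi.2
      have hsx := hi.1
      rw [hx] at hsx
      exact hF' i hi.1 x (by exact_mod_cast hsx.le) (mem_of_cost_eq ((heq i).symm.trans hx))

/-! ### Removing cycles -/

lemma CanEnforce.congr {G : QRGame ι V} {v₀ v : V} {ρ ρ' : ℕ → V} {l : ℕ}
    {P Q : (ℕ → V) → Prop} (h : G.CanEnforce v₀ ρ l v P) (hle : ∀ m ≤ l, ρ' m = ρ m)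
    (hPQ : ∀ π, P π → Q π) : G.CanEnforce v₀ ρ' l v Q := by
  obtain ⟨τ, hτ, hP⟩ := h
  refine ⟨τ, hτ, fun π hπ => hPQ π (hP π fun k => ?_)⟩
  obtain ⟨h1, h2, h3, h4⟩ := hπ k
  rw [hle l le_rfl] at h4
  exact ⟨h1, fun m hm => (h2 m hm).trans (hle m hm), h3, h4⟩

/-- The sequence `π` with the `δ` steps of `ρ` from time `a` on inserted at time `a`. -/
def insertSteps (ρ : ℕ → V) (a δ : ℕ) (π : ℕ → V) (t : ℕ) : V :=
  if t < a + δ then ρ t else π (t - δ)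

/-- The sequence `ρ` with the `δ` steps from time `a` on removed. -/
def removeSteps (ρ : ℕ → V) (a δ : ℕ) (t : ℕ) : V :=
  if t ≤ a then ρ t else ρ (t + δ)

lemma insertSteps_add {ρ π : ℕ → V} {a δ t : ℕ} (ht : a ≤ t) :
    insertSteps ρ a δ π (t + δ) = π t := by
  rw [insertSteps, if_neg (by omega), Nat.add_sub_cancel]

lemma removeSteps_of_ge {ρ : ℕ → V} {a δ t : ℕ} (hρ : ρ (a + δ) = ρ a) (ht : a ≤ t) :
    removeSteps ρ a δ t = ρ (t + δ) := by
  unfold removeSteps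
  split_ifs with h
  · obtain rfl : t = a := by omega
    exact hρ.symm
  · rfl

lemma insertSteps_eq {ρ π : ℕ → V} {a δ t : ℕ} (hρ : ρ (a + δ) = ρ a) (hπ : π a = ρ a)
    (ht : t ≤ a + δ) : insertSteps ρ a δ π t = ρ t := by
  unfold insertSteps
  split_ifs with h
  · rfl
  · obtain rfl : t = a + δ := by omega
    rw [Nat.add_sub_cancel, hπ, hρ]

lemma insertSteps_removeSteps {ρ : ℕ → V} {a δ : ℕ} (hρ : ρ (a + δ) = ρ a) :
    insertSteps ρ a δ (removeSteps ρ a δ) = ρ := by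
  funext t
  rcases Nat.lt_or_ge t (a + δ) with h | h
  · exact if_pos h
  · obtain ⟨t, rfl⟩ : ∃ t', t = t' + δ := ⟨t - δ, by omega⟩
    rw [insertSteps_add (by omega), removeSteps_of_ge hρ (by omega)]

lemma IsPlay.insertSteps {G : QRGame ι V} {v₀ : V} {ρ π : ℕ → V} {a δ : ℕ}
    (hρ : G.IsPlay v₀ ρ) (hπ : G.IsPlay v₀ π) (hcyc : ρ (a + δ) = ρ a) (ha : π a = ρ a) :
    G.IsPlay v₀ (insertSteps ρ a δ π) := by
  refine ⟨(insertSteps_eq hcyc ha (Nat.zero_le _)).trans hρ.1, fun k => ?_⟩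
  rcases Nat.lt_or_ge k (a + δ) with h | h
  · rw [insertSteps_eq hcyc ha h.le, insertSteps_eq hcyc ha h]
    exact hρ.2 k
  · obtain ⟨k, rfl⟩ : ∃ k', k = k' + δ := ⟨k - δ, by omega⟩
    rw [insertSteps_add (by omega), show k + δ + 1 = k + 1 + δ by omega,
      insertSteps_add (by omega)]
    exact hπ.2 k

lemma IsPlay.removeSteps {G : QRGame ι V} {v₀ : V} {ρ : ℕ → V} {a δ : ℕ}
    (hρ : G.IsPlay v₀ ρ) (hcyc : ρ (a + δ) = ρ a) : G.IsPlay v₀ (removeSteps ρ a δ) := by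
  refine ⟨(if_pos (Nat.zero_le _)).trans hρ.1, fun k => ?_⟩
  rcases Nat.lt_or_ge k a with h | h
  · simp only [QRGame.removeSteps, if_pos h.le, if_pos (Nat.succ_le_of_lt h)]
    exact hρ.2 k
  · rw [removeSteps_of_ge hcyc h, removeSteps_of_ge hcyc (by omega),
      show k + 1 + δ = k + δ + 1 by omega]
    exact hρ.2 _

lemma cost_insertSteps_of_gt {G : QRGame ι V} {ρ π : ℕ → V} {a δ : ℕ} {i : ι}
    (hcyc : ρ (a + δ) = ρ a) (hle : ∀ t ≤ a, π t = ρ t) (hi : (a + δ : ℕ) < G.cost i ρ) :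
    G.cost i (insertSteps ρ a δ π) = G.cost i π + δ := by
  have hρ : ∀ t ≤ a + δ, ρ t ∉ G.F i := fun t ht hF =>
    (hi.trans_le (cost_le hF)).not_ge (by exact_mod_cast ht)
  refine le_antisymm ?_ ?_
  · by_cases htop : G.cost i π = ⊤
    · simp [htop]
    obtain ⟨x, hx⟩ := exists_cost_eq htop
    have hF := mem_of_cost_eq hx
    have hax : a ≤ x := by
      by_contra! h
      rw [hle x h.le] at hF
      exact hρ x (by omega) hF
    have := cost_le (G := G) (i := i) (π := insertSteps ρ a δ π) (l := x + δ)
      (by rw [insertSteps_add hax]; exact hF)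
    rw [hx]
    push_cast at this
    exact this
  · rw [le_cost_iff]
    intro l hF
    rcases Nat.lt_or_ge l (a + δ) with h | h
    · rw [insertSteps_eq hcyc (hle a le_rfl) h.le] at hF
      exact absurd hF (hρ l h.le)
    · obtain ⟨l, rfl⟩ : ∃ l', l = l' + δ := ⟨l - δ, by omega⟩
      rw [insertSteps_add (by omega)] at hF
      push_cast
      gcongr
      exact cost_le hF

lemma cost_removeSteps_of_le {G : QRGame ι V} {ρ : ℕ → V} {a δ : ℕ} {i : ι}
    (hi : G.cost i ρ ≤ a) : G.cost i (removeSteps ρ a δ) = G.cost i ρ :=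
  cost_eq_of_agree (fun _ hm => (if_pos hm).symm) hi

lemma cost_removeSteps_of_gt {G : QRGame ι V} {ρ : ℕ → V} {a δ : ℕ} {i : ι}
    (hcyc : ρ (a + δ) = ρ a) (hi : (a + δ : ℕ) < G.cost i ρ) :
    G.cost i (removeSteps ρ a δ) + δ = G.cost i ρ := by
  rw [← cost_insertSteps_of_gt (π := removeSteps ρ a δ) hcyc (fun _ ht => if_pos ht) hi,
    insertSteps_removeSteps hcyc]

/-- A cycle that ends at least `|V|` steps before any new goal is reached can be removed from the
outcome of a secure equilibrium. -/
lemma Deterred.removeSteps [Fintype V] {G : QRGame ι V} {v₀ : V} {ρ : ℕ → V} {a δ : ℕ}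
    (hρ : G.IsPlay v₀ ρ)
    (h : G.Deterred v₀ ρ fun j π => ¬ Prec j (fun i => G.cost i ρ) fun i => G.cost i π)
    (hcyc : ρ (a + δ) = ρ a) (hδ : 0 < δ)
    (hgap : ∀ i, G.cost i ρ ≤ a ∨ (a + δ + Fintype.card V : ℕ) ≤ G.cost i ρ)
    (hnew : ∃ i, (a : ℕ∞) < G.cost i ρ ∧ G.cost i ρ ≠ ⊤) :
    G.Deterred v₀ (removeSteps ρ a δ) fun j π =>
      ¬ Prec j (fun i => G.cost i (removeSteps ρ a δ)) fun i => G.cost i π := by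
  have hV : 0 < Fintype.card V := Fintype.card_pos_iff.2 ⟨v₀⟩
  have hgap' : ∀ i, G.cost i ρ ≤ a ∨ (a + δ : ℕ) < G.cost i ρ := fun i =>
    (hgap i).imp_right fun hi => lt_of_lt_of_le (by exact_mod_cast (by omega)) hi
  have hδtop : (δ : ℕ∞) ≠ ⊤ := ENat.natCast_ne_top δ
  intro l v hE hne
  rcases Nat.lt_or_ge l a with hl | hl
  · have hle : ∀ m ≤ a, QRGame.removeSteps ρ a δ m = ρ m := fun m hm => if_pos hm
    rw [hle l hl.le] at hE ⊢
    rw [hle (l + 1) hl] at hne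
    have hpun := h l v hE hne
    set j := G.owner (ρ l) with hj
    by_cases hcj : G.cost j ρ ≤ a ∨ G.cost j ρ = ⊤
    · refine (hpun.accelerate hj.symm hl hcj).congr (fun m hm => hle m (by omega)) ?_
      have hcj' : G.cost j (QRGame.removeSteps ρ a δ) = G.cost j ρ := by
        rcases hcj with hcj | hcj
        · exact cost_removeSteps_of_le hcj
        · have := cost_removeSteps_of_gt hcyc (i := j) (by rw [hcj]; exact ENat.natCast_lt_top _)
          rw [hcj] at this ⊢
          by_contra hne
          exact (ENat.add_lt_top.2 ⟨lt_top_iff_ne_top.2 hne, ENat.natCast_lt_top δ⟩).ne this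
      rintro π ⟨h1, h2⟩ (hlt | ⟨heq, hall, -⟩)
      · exact hlt.not_ge (hcj'.trans_le h1)
      · simp only at h1 h2 heq hall
        rw [hcj'] at heq
        rcases h2 with h2 | ⟨i, hi, h2⟩ | ⟨i, hi, h2⟩ | ⟨-, h2⟩
        · exact h2.ne heq
        · have := hall i
          rw [cost_removeSteps_of_le hi] at this
          exact h2.not_ge this
        · have h3 := (hgap i).resolve_left hi.not_ge
          have h4 := cost_removeSteps_of_gt hcyc ((hgap' i).resolve_left hi.not_ge)
          have h5 : G.cost i (QRGame.removeSteps ρ a δ) + δ < (a + Fintype.card V : ℕ) + δ :=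
            (ENat.add_lt_add_iff_right hδtop).2 ((hall i).trans_lt h2)
          rw [h4] at h5
          refine h5.not_ge (le_trans ?_ h3)
          exact_mod_cast (by omega)
        · obtain ⟨i, hi, hi'⟩ := hnew
          rcases h2 i with h2 | h2
          · exact hi.not_ge h2
          · exact hi' h2
    · push Not at hcj
      refine hpun.congr (fun m hm => hle m (by omega)) ?_
      intro π hπ hprec
      apply hπ
      have h3 := cost_removeSteps_of_gt hcyc ((hgap' j).resolve_left hcj.1.not_ge)
      have h4 : G.cost j (QRGame.removeSteps ρ a δ) < G.cost j ρ := by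
        rw [← h3]
        have hne : G.cost j (QRGame.removeSteps ρ a δ) ≠ ⊤ := by
          intro htop
          rw [htop, top_add] at h3
          exact hcj.2 h3.symm
        rw [add_comm]
        exact ENat.lt_add_left hne (by exact_mod_cast hδ)
      left
      rcases hprec with hlt | ⟨heq, -, -⟩
      · exact hlt.trans h4
      · exact heq ▸ h4
  · rw [removeSteps_of_ge hcyc hl] at hE ⊢
    rw [removeSteps_of_ge hcyc (by omega), show l + 1 + δ = l + δ + 1 by omega] at hne
    obtain ⟨τ, hτ, hP⟩ := h (l + δ) v hE hne
    let ins : List V → List V := fun h =>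
      pre (QRGame.insertSteps ρ a δ fun t => h.reverse.getD t v₀) (h.length - 1 + δ)
    have hins : ∀ π m, ins (pre π m) = pre (QRGame.insertSteps ρ a δ π) (m + δ) := by
      intro π m
      simp only [ins, length_pre, Nat.add_sub_cancel]
      refine pre_congr fun t ht => ?_
      simp only [QRGame.insertSteps]
      split_ifs with h
      · rfl
      · exact getD_reverse_pre v₀ π (by omega)
    refine ⟨G.legalize v₀ fun h => τ (ins h), G.isMove_legalize v₀ _, fun π hπ => ?_⟩
    obtain ⟨hplay, hagree, hv, -⟩ := hπ 0
    have hle : ∀ t ≤ a, π t = ρ t := fun t ht => (hagree t (by omega)).trans (if_pos ht)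
    have hplay' := hρ.insertSteps hplay hcyc (hle a le_rfl)
    have hP' := hP (QRGame.insertSteps ρ a δ π) fun k => by
      refine ⟨hplay', fun m hm => ?_, ?_, fun m h1 _ h3 => ?_⟩
      · rcases Nat.lt_or_ge m (a + δ) with hm' | hm'
        · exact if_pos hm'
        · obtain ⟨m, rfl⟩ : ∃ m', m = m' + δ := ⟨m - δ, by omega⟩
          rw [insertSteps_add (by omega), hagree m (by omega), removeSteps_of_ge hcyc (by omega)]
      · rw [show l + δ + 1 = l + 1 + δ by omega, insertSteps_add (by omega), hv]
      · obtain ⟨m, rfl⟩ : ∃ m', m = m' + δ := ⟨m - δ, by omega⟩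
        rw [insertSteps_add (by omega)] at h3
        rw [show m + δ + 1 = m + 1 + δ by omega, insertSteps_add (by omega),
          (hπ (m + 1)).2.2.2 m (by omega) (by omega) (by rwa [removeSteps_of_ge hcyc hl]),
          legalize_eq] <;> rw [hins]
        have := hτ (pre (QRGame.insertSteps ρ a δ π) (m + δ))
        rw [cur_pre, insertSteps_add (by omega)] at this
        rwa [cur_pre]
    refine mt (fun hprec => ?_) hP'
    have hcost : ∀ i, (G.cost i (QRGame.removeSteps ρ a δ) = G.cost i ρ ∧
        G.cost i π = G.cost i ρ ∧ G.cost i (QRGame.insertSteps ρ a δ π) = G.cost i ρ) ∨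
        (G.cost i ρ = G.cost i (QRGame.removeSteps ρ a δ) + δ ∧
          G.cost i (QRGame.insertSteps ρ a δ π) = G.cost i π + δ) := by
      intro i
      rcases hgap' i with hi | hi
      · refine Or.inl ⟨cost_removeSteps_of_le hi,
          cost_eq_of_agree (fun t ht => (hle t ht).symm) hi,
          cost_eq_of_agree (fun t ht => ?_) hi⟩
        exact (insertSteps_eq hcyc (hle a le_rfl) (by omega)).symm
      · exact Or.inr ⟨(cost_removeSteps_of_gt hcyc hi).symm, cost_insertSteps_of_gt hcyc hle hi⟩
    have hlt : ∀ {x y : ℕ∞}, x < y → x + δ < y + δ := (ENat.add_lt_add_iff_right hδtop).2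
    rcases hprec with hlt' | ⟨heq, hall, i, hi⟩
    · left
      rcases hcost (G.owner (ρ (l + δ))) with ⟨h1, h2, h3⟩ | ⟨h1, h2⟩
      · dsimp only at hlt'
        rw [h1, h2] at hlt'
        exact absurd hlt' (lt_irrefl _)
      · simp only [h1, h2]
        exact hlt hlt'
    · refine Or.inr ⟨?_, fun k => ?_, i, ?_⟩
      · rcases hcost (G.owner (ρ (l + δ))) with ⟨h1, h2, h3⟩ | ⟨h1, h2⟩
        · exact h3.symm
        · simp only at heq
          simp only [h1, h2, heq]
      · rcases hcost k with ⟨h1, h2, h3⟩ | ⟨h1, h2⟩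
        · exact h3.ge
        · have := hall k
          simp only [h1, h2] at this ⊢
          gcongr
      · rcases hcost i with ⟨h1, h2, h3⟩ | ⟨h1, h2⟩
        · simp only [h1, h2, lt_irrefl] at hi
        · simp only [h1, h2]
          exact hlt hi

/-! ### Goal-optimality -/

lemma isSecure_iff [DecidableEq ι] {G : QRGame ι V} {v₀ : V} {σ : ι → List V → V}
    (hσ : G.IsProfile v₀ σ) :
    G.IsSecure v₀ σ ↔ ∀ j π, G.IsPlay v₀ π → G.IsConsistent σ j π →
      ¬ Prec j (fun i => G.cost i (G.outcome v₀ σ)) fun i => G.cost i π := by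
  constructor
  · intro h j π hπ hcons hprec
    obtain ⟨σ', hσ', hout⟩ := hπ.exists_deviation (σ := σ) (j := j)
    refine h ⟨j, σ', fun h _ _ => hσ' h, ?_⟩
    have : G.outcome v₀ (Function.update σ j σ') = π :=
      funext fun k => hout k (fun m _ => hcons m) k le_rfl
    rw [← this] at hprec
    exact hprec
  · rintro h ⟨j, σ', hσ', hprec⟩
    refine h j (G.outcome v₀ (Function.update σ j σ')) (IsPlay.outcome fun i => ?_)
      (G.isConsistent_outcome_update v₀ σ j σ') hprec
    by_cases hi : i = j
    · subst hi
      rwa [Function.update_self]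
    · rw [Function.update_of_ne hi]
      exact hσ i

lemma exists_repetition [Fintype V] (π : ℕ → V) (s : ℕ) :
    ∃ a b, s ≤ a ∧ a < b ∧ b ≤ s + Fintype.card V ∧ π b = π a := by
  obtain ⟨x, y, hne, hxy⟩ := Fintype.exists_ne_map_eq_of_card_lt
    (fun x : Fin (Fintype.card V + 1) => π (s + x)) (by simp)
  have hx := x.isLt
  have hy := y.isLt
  rcases Nat.lt_or_gt_of_ne (Fin.val_ne_of_ne hne) with h | h
  · exact ⟨s + x, s + y, by omega, by omega, by omega, hxy.symm⟩
  · exact ⟨s + y, s + x, by omega, by omega, by omega, hxy⟩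

/-- A secure outcome can be improved so that goals are reached at short intervals. -/
lemma Deterred.exists_short_gaps [Fintype ι] [Fintype V] {G : QRGame ι V} {v₀ : V} {ρ : ℕ → V}
    (hρ : G.IsPlay v₀ ρ)
    (h : G.Deterred v₀ ρ fun j π => ¬ Prec j (fun i => G.cost i ρ) fun i => G.cost i π) :
    ∃ ρ', G.IsPlay v₀ ρ' ∧
      (G.Deterred v₀ ρ' fun j π => ¬ Prec j (fun i => G.cost i ρ') fun i => G.cost i π) ∧
      (∀ i, G.cost i ρ' ≤ G.cost i ρ) ∧
      ∀ s : ℕ, (∃ i, (s : ℕ∞) < G.cost i ρ' ∧ G.cost i ρ' ≠ ⊤) →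
        ∃ i, (s : ℕ∞) < G.cost i ρ' ∧ G.cost i ρ' < (s + 2 * Fintype.card V : ℕ) := by
  induction hx : ∑ i, (G.cost i ρ).toNat using Nat.strong_induction_on generalizing ρ with
  | _ x ih =>
    subst hx
    by_cases hgap : ∀ s : ℕ, (∃ i, (s : ℕ∞) < G.cost i ρ ∧ G.cost i ρ ≠ ⊤) →
        ∃ i, (s : ℕ∞) < G.cost i ρ ∧ G.cost i ρ < (s + 2 * Fintype.card V : ℕ)
    · exact ⟨ρ, hρ, h, fun _ => le_rfl, hgap⟩
    push Not at hgap
    obtain ⟨s, ⟨i₀, hi₀, hi₀'⟩, hgap⟩ := hgap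
    obtain ⟨a, b, hsa, hab, hb, hcyc⟩ := exists_repetition ρ s
    obtain ⟨δ, hδ, rfl⟩ : ∃ δ, 0 < δ ∧ b = a + δ := ⟨b - a, by omega, by omega⟩
    have hV : 0 < Fintype.card V := Fintype.card_pos_iff.2 ⟨v₀⟩
    have hgap' : ∀ i, G.cost i ρ ≤ a ∨ (a + δ + Fintype.card V : ℕ) ≤ G.cost i ρ := by
      intro i
      rcases le_or_gt (G.cost i ρ) s with hi | hi
      · exact Or.inl (hi.trans (by exact_mod_cast hsa))
      · exact Or.inr (le_trans (by exact_mod_cast (by omega)) (hgap i hi))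
    have hgap'' : ∀ i, G.cost i ρ ≤ a ∨ (a + δ : ℕ) < G.cost i ρ := fun i =>
      (hgap' i).imp_right fun hi => lt_of_lt_of_le (by exact_mod_cast (by omega)) hi
    have hle : ∀ i, G.cost i (QRGame.removeSteps ρ a δ) ≤ G.cost i ρ := by
      intro i
      rcases hgap'' i with hi | hi
      · exact (cost_removeSteps_of_le hi).le
      · rw [← cost_removeSteps_of_gt hcyc hi]
        exact le_self_add
    have ha : (a : ℕ∞) < G.cost i₀ ρ :=
      lt_of_lt_of_le (by exact_mod_cast (by omega)) (hgap i₀ hi₀)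
    have hlt : ∑ i, (G.cost i (QRGame.removeSteps ρ a δ)).toNat < ∑ i, (G.cost i ρ).toNat := by
      refine Finset.sum_lt_sum (fun i _ => ?_) ⟨i₀, Finset.mem_univ _, ?_⟩
      · by_cases htop : G.cost i ρ = ⊤
        · rcases hgap'' i with hi | hi
          · rw [cost_removeSteps_of_le hi]
          · have := cost_removeSteps_of_gt hcyc hi
            rw [htop] at this
            have h5 : G.cost i (QRGame.removeSteps ρ a δ) = ⊤ := by
              by_contra hne
              exact (ENat.add_lt_top.2 ⟨lt_top_iff_ne_top.2 hne, ENat.natCast_lt_top δ⟩).ne this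
            rw [h5, htop]
        · exact ENat.toNat_le_toNat (hle i) htop
      · have h5 := cost_removeSteps_of_gt hcyc ((hgap'' i₀).resolve_left ha.not_ge)
        obtain ⟨y, hy⟩ := exists_cost_eq (ne_top_of_le_ne_top hi₀' (hle i₀))
        rw [← h5, hy, ← Nat.cast_add, ENat.toNat_natCast, ENat.toNat_natCast]
        omega
    obtain ⟨ρ', h1, h2, h3, h4⟩ := ih _ hlt (hρ.removeSteps hcyc)
      (h.removeSteps hρ hcyc hδ hgap' ⟨i₀, ha, hi₀'⟩) rfl
    exact ⟨ρ', h1, h2, fun i => (h3 i).trans (hle i), h4⟩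

lemma lt_of_short_gaps [Fintype ι] {c : ι → ℕ∞} {N : ℕ} (hN : 0 < N)
    (h : ∀ s : ℕ, (∃ i, (s : ℕ∞) < c i ∧ c i ≠ ⊤) → ∃ i, (s : ℕ∞) < c i ∧ c i < (s + N : ℕ))
    {i : ι} (hi : c i ≠ ⊤) : c i < (N * Fintype.card ι : ℕ) := by
  by_contra! hc
  have hs : ∀ q : Fin (Fintype.card ι),
      ∃ i, ((N * q : ℕ) : ℕ∞) < c i ∧ c i < (N * q + N : ℕ) := by
    refine fun q => h _ ⟨i, lt_of_lt_of_le ?_ hc, hi⟩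
    exact_mod_cast Nat.mul_lt_mul_of_pos_left q.isLt hN
  choose f hf1 hf2 using hs
  have hinj : Function.Injective f := by
    have key : ∀ q r, f q = f r → (q : ℕ) ≤ r := by
      intro q r hqr
      have := (hf1 q).trans (hqr ▸ hf2 r)
      norm_cast at this
      by_contra! hlt
      have := Nat.mul_le_mul_left N (Nat.succ_le_of_lt hlt)
      rw [Nat.mul_succ] at this
      omega
    exact fun q r hqr => Fin.ext (le_antisymm (key q r hqr) (key r q hqr.symm))
  obtain ⟨q, rfl⟩ := ((Fintype.bijective_iff_injective_and_card f).2 ⟨hinj, by simp⟩).2 i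
  refine (hf2 q).not_ge (le_trans ?_ hc)
  rw [← Nat.mul_succ]
  exact_mod_cast Nat.mul_le_mul_left N (Nat.succ_le_of_lt q.isLt)

/-! ### Truncation -/

lemma exists_devBoundTrunc_eq [Fintype ι] [Fintype V] (G : QRGame ι V) (v₀ : V) (d : ℕ)
    (σ : ι → List V → V) :
    ∃ M : ℕ, G.devBoundTrunc v₀ d σ = M + Fintype.card V ∧
      (∀ i, G.costLT i (G.outcome v₀ σ) (d + 1) ≠ ⊤ →
        G.costLT i (G.outcome v₀ σ) (d + 1) ≤ M) ∧
      (M = 0 ∨ ∃ i, G.costLT i (G.outcome v₀ σ) (d + 1) = M) := by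
  refine ⟨_, rfl, ?_⟩
  set c : ι → ℕ∞ := fun i => G.costLT i (G.outcome v₀ σ) (d + 1) with hc
  change (∀ i, c i ≠ ⊤ → c i ≤ _) ∧ (_ ∨ ∃ i, c i = _)
  rcases {i | c i ≠ ⊤}.eq_empty_or_nonempty with he | hne
  · refine ⟨fun i hi => absurd (he ▸ hi : i ∈ (∅ : Set ι)) (Set.notMem_empty i), Or.inl ?_⟩
    change (⨆ i ∈ {i | c i ≠ ⊤}, c i).toNat = 0
    simp [he]
  · obtain ⟨i, hi, hmax⟩ := Set.exists_max_image _ c (Set.toFinite _) hne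
    have hsup : ⨆ i ∈ {i | c i ≠ ⊤}, c i = c i :=
      le_antisymm (iSup₂_le hmax) (le_iSup₂_of_le i hi le_rfl)
    change (∀ i, c i ≠ ⊤ → c i ≤ ((⨆ i ∈ {i | c i ≠ ⊤}, c i).toNat : ℕ)) ∧
      (_ ∨ ∃ k, c k = ((⨆ i ∈ {i | c i ≠ ⊤}, c i).toNat : ℕ))
    rw [hsup, ENat.natCast_toNat hi]
    exact ⟨hmax, Or.inr ⟨i, rfl⟩⟩

/-- If all goals are reached by time `s`, then deviations can be punished before time
`s + |V|`. -/
lemma Deterred.settledBy [Fintype V] {G : QRGame ι V} {v₀ : V} {ρ : ℕ → V} {s : ℕ}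
    (hs : ∀ i, G.cost i ρ ≠ ⊤ → G.cost i ρ ≤ s)
    (h : G.Deterred v₀ ρ fun j π => ¬ Prec j (fun i => G.cost i ρ) fun i => G.cost i π) :
    G.Deterred v₀ ρ fun j π =>
      SettledBy (fun i => G.cost i ρ) (fun i => G.cost i π) j s (Fintype.card V) := by
  have hs' : ∀ i, G.cost i ρ ≤ s ∨ G.cost i ρ = ⊤ := fun i => by
    by_cases hi : G.cost i ρ = ⊤
    · exact Or.inr hi
    · exact Or.inl (hs i hi)
  intro l v hE hne
  rcases Nat.lt_or_ge l s with hl | hl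
  · exact (h l v hE hne).accelerate rfl hl (hs' _)
  · obtain ⟨τ, hτ, hP⟩ := h l v hE hne
    refine ⟨τ, hτ, fun π hπ => ⟨?_, Or.inr (Or.inr (Or.inr ⟨fun i hi => ?_, hs'⟩))⟩⟩
    · by_contra! hlt
      exact hP π hπ (Or.inl hlt)
    · exact cost_eq_of_agree (fun m hm => ((hπ 0).2.1 m (by omega)).symm) hi

lemma SettledBy.not_prec_costLT {G : QRGame ι V} {ρ π : ℕ → V} {j : ι} {s N m : ℕ}
    (hs : ∀ i, G.cost i ρ ≠ ⊤ → G.cost i ρ ≤ s) (hN : 0 < N) (hm : s + N ≤ m)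
    (h : SettledBy (fun i => G.cost i ρ) (fun i => G.cost i π) j s N) :
    ¬ Prec j (fun i => G.costLT i ρ m) fun i => G.costLT i π m := by
  have hsm : (s : ℕ∞) < m := by exact_mod_cast (by omega)
  have hρ : ∀ i, G.costLT i ρ m = G.cost i ρ := by
    intro i
    by_cases hi : G.cost i ρ = ⊤
    · rw [hi]
      exact costLT_eq_top (by simp [hi])
    · exact costLT_eq_cost ((hs i hi).trans_lt hsm)
  simp only [hρ]
  obtain ⟨h1, h2⟩ := h
  dsimp only at h1 h2
  rintro (hlt | ⟨heq, hall, i, hi⟩)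
  · exact (h1.trans (cost_le_costLT G j π m)).not_gt hlt
  · dsimp only at heq hall hi
    rcases h2 with h2 | ⟨i, hi, h2⟩ | ⟨i, hi, h2⟩ | ⟨h2, -⟩
    · exact (h2.trans_le (cost_le_costLT G j π m)).ne heq
    · refine h2.not_ge ?_
      rw [← costLT_eq_cost ((h2.trans_le hi).trans hsm)]
      exact hall i
    · have h3 := hall i
      rw [costLT_eq_cost (h2.trans_le (by exact_mod_cast hm))] at h3
      by_cases htop : G.cost i ρ = ⊤
      · rw [htop, top_le_iff] at h3
        exact h2.ne_top h3
      · exact hi.not_ge (hs i htop)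
    · have h3 := hs i hi.ne_top
      have h4 := h2 i h3
      rw [costLT_eq_cost (h4.trans_lt (h3.trans_lt hsm)), h4] at hi
      exact lt_irrefl _ hi

/-- A secure outcome which reaches all its goals early is the outcome of a goal-optimal and
dev-optimal secure equilibrium of the truncated game. -/
lemma Deterred.exists_trunc [Fintype ι] [Fintype V] [DecidableEq ι] {G : QRGame ι V} {v₀ : V}
    {ρ : ℕ → V} {Γ d : ℕ} (hρ : G.IsPlay v₀ ρ)
    (h : G.Deterred v₀ ρ fun j π => ¬ Prec j (fun i => G.cost i ρ) fun i => G.cost i π)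
    (hΓ0 : 0 < Γ) (hΓ : ∀ i, G.cost i ρ ≠ ⊤ → G.cost i ρ < Γ) (hd : Γ + Fintype.card V ≤ d) :
    ∃ σ : ι → List V → V, (∀ i, G.IsStratTrunc v₀ d i (σ i)) ∧ G.IsSecureTrunc v₀ d σ ∧
      G.GoalOptTrunc v₀ d σ Γ ∧ G.DevOptTrunc v₀ d σ ∧
      ∀ i, G.costLT i (G.outcome v₀ σ) (d + 1) = G.cost i ρ := by
  have hV : 0 < Fintype.card V := Fintype.card_pos_iff.2 ⟨v₀⟩
  have hcost : ∀ i, G.costLT i ρ (d + 1) = G.cost i ρ := by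
    intro i
    by_cases hi : G.cost i ρ = ⊤
    · rw [hi]
      exact costLT_eq_top (by simp [hi])
    · exact costLT_eq_cost ((hΓ i hi).trans (by exact_mod_cast (by omega)))
  obtain ⟨M, hM, hM1, hM2⟩ : ∃ M : ℕ, (∀ σ, G.outcome v₀ σ = ρ →
      G.devBoundTrunc v₀ d σ = M + Fintype.card V) ∧ (∀ i, G.cost i ρ ≠ ⊤ → G.cost i ρ ≤ M) ∧
      M < Γ := by
    obtain ⟨σ, -, hσ, -⟩ := h.exists_profile hρ fun j => by simp [Prec]
    obtain ⟨M, h1, h2, h3⟩ := G.exists_devBoundTrunc_eq v₀ d σ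
    simp only [hσ, hcost] at h2 h3
    refine ⟨M, fun σ' hσ' => ?_, h2, ?_⟩
    · rw [← h1, devBoundTrunc, devBoundTrunc, hσ, hσ']
    · rcases h3 with rfl | ⟨i, hi⟩
      · exact hΓ0
      · have := hΓ i (by simp [hi])
        rw [hi] at this
        exact_mod_cast this
  obtain ⟨σ, hσ, hout, hset⟩ := (h.settledBy hM1).exists_profile hρ fun j =>
    ⟨le_rfl, Or.inr (Or.inr (Or.inr ⟨fun _ _ => rfl, fun i => by
      by_cases hi : G.cost i ρ = ⊤
      · exact Or.inr hi
      · exact Or.inl (hM1 i hi)⟩))⟩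
  have key : ∀ m, M + Fintype.card V ≤ m → m ≤ d + 1 → ∀ j σ', G.IsStratTrunc v₀ d j σ' →
      ¬ Prec j (fun i => G.costLT i (G.outcome v₀ σ) m)
        fun i => G.costLT i (G.outcome v₀ (Function.update σ j σ')) m := by
    intro m hm hmd j σ' hσ'
    obtain ⟨π, hπ, hcons, hagree⟩ := exists_isPlay_of_deviation_trunc hσ hσ'
    have : ∀ i, G.costLT i (G.outcome v₀ (Function.update σ j σ')) m = G.costLT i π m :=
      fun i => costLT_congr fun l hl => hagree l (by omega)
    simp only [hout, this]
    exact (hset j π hπ hcons).not_prec_costLT hM1 hV hm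
  refine ⟨σ, fun i h hh _ => hσ i h hh, ?_, fun i => ?_, fun j σ' hσ' => ?_, fun i => ?_⟩
  · rintro ⟨j, σ', hσ', hprec⟩
    exact key (d + 1) (by omega) le_rfl j σ' hσ' hprec
  · rw [hout, hcost]
    exact hΓ i
  · rw [hM σ hout]
    exact key _ le_rfl (by omega) j σ' hσ'
  · rw [hout, hcost]

/-! ### From truncated equilibria to equilibria -/

/-- In `π` all players other than `j` follow the choice function `s` up to time `k`. -/
def Follows (G : QRGame ι V) (s : List V → V) (j : ι) (k : ℕ) (π : ℕ → V) : Prop :=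
  ∀ m < k, G.owner (π m) ≠ j → π (m + 1) = s (pre π m)

lemma Follows.mono {G : QRGame ι V} {s : List V → V} {j : ι} {k l : ℕ} {π : ℕ → V}
    (h : G.Follows s j k π) (hlk : l ≤ k) : G.Follows s j l π :=
  fun m hm => h m (by omega)

lemma Follows.congr {G : QRGame ι V} {s : List V → V} {j : ι} {k : ℕ} {π π' : ℕ → V}
    (h : G.Follows s j k π) (hle : ∀ m ≤ k, π' m = π m) : G.Follows s j k π' := by
  intro m hm hj
  rw [hle m hm.le] at hj
  rw [hle (m + 1) hm, h m hm hj, pre_congr fun t ht => hle t (by omega)]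

lemma Follows.exists_extend {G : QRGame ι V} {v₀ : V} {s g : List V → V} {j : ι} {k : ℕ}
    {π : ℕ → V} (hπ : G.IsPlay v₀ π) (h : G.Follows s j k π) (hg : G.IsMove v₀ g)
    (hgs : ∀ h, G.owner (cur v₀ h) ≠ j → g h = s h) (d : ℕ) :
    ∃ π', G.IsPlay v₀ π' ∧ (∀ m ≤ k, π' m = π m) ∧ G.Follows s j d π' ∧
      ∀ m, k ≤ m → π' (m + 1) = g (pre π' m) := by
  obtain ⟨π', h1, h2, h3⟩ := hπ.exists_extend hg k
  refine ⟨π', h1, h2, fun m _ hj => ?_, h3⟩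
  rcases Nat.lt_or_ge m k with hm | hm
  · exact h.congr h2 m hm hj
  · rw [h3 m hm, hgs _ (by rwa [cur_pre])]

/-- If player `j` never reaches a goal within time `d`, then he can never force a visit to his goal
set in the remaining time. -/
lemma Follows.notMem_attr [Fintype V] {G : QRGame ι V} {v₀ : V} {s : List V → V} {j : ι}
    {d k : ℕ} {π : ℕ → V} (hs : G.IsMove v₀ s)
    (hd : ∀ π, G.IsPlay v₀ π → G.Follows s j d π → G.costLT j π (d + 1) = ⊤)
    (hπ : G.IsPlay v₀ π) (h : G.Follows s j k π) (hk : k + (Fintype.card V - 1) ≤ d) :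
    π k ∉ G.attr {x | G.owner x = j} Set.univ (G.F j) (Fintype.card V - 1) := by
  intro hA
  obtain ⟨p, hpE, -, hp⟩ := G.exists_attr_move {x | G.owner x = j} Set.univ (G.F j)
    (Set.subset_univ _) fun v _ _ => (G.total v).imp fun w hw => ⟨hw, trivial⟩
  obtain ⟨π', h1, h2, h3, h4⟩ := h.exists_extend hπ
    (g := fun h => if G.owner (cur v₀ h) = j then p (cur v₀ h) else s h)
    (fun h => by
      dsimp only
      split_ifs
      · exact hpE _
      · exact hs h)
    (fun h hj => if_neg hj) d
  obtain ⟨m, -, hm, hF⟩ := exists_mem_of_attr hp h1.2 (s := k)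
    (fun m hm hC => by
      rw [h4 m hm, cur_pre]
      exact if_pos hC) (h2 k le_rfl ▸ hA)
  exact notMem_of_costLT_eq_top (hd π' h1 h3) (show m < d + 1 by omega) hF

/-- A play with a cycle can be turned into an ultimately periodic play. -/
lemma IsPlay.exists_lasso {G : QRGame ι V} {v₀ : V} {ρ : ℕ → V} {a b : ℕ}
    (hρ : G.IsPlay v₀ ρ) (hab : a < b) (hcyc : ρ b = ρ a) :
    ∃ ρ', G.IsPlay v₀ ρ' ∧ (∀ t < b, ρ' t = ρ t) ∧ ∀ t, ∃ t' < b, ρ' t = ρ t' := by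
  let f : ℕ → ℕ := fun t => Nat.rec 0 (fun _ x => if x + 1 = b then a else x + 1) t
  have hf : ∀ t, f (t + 1) = if f t + 1 = b then a else f t + 1 := fun _ => rfl
  have hlt : ∀ t, f t < b := by
    intro t
    induction t with
    | zero => exact (Nat.zero_le a).trans_lt hab
    | succ t ih =>
      rw [hf]
      split_ifs <;> omega
  have heq : ∀ t < b, f t = t := by
    intro t ht
    induction t with
    | zero => rfl
    | succ t ih => rw [hf, ih (by omega), if_neg (by omega)]
  refine ⟨fun t => ρ (f t), ⟨hρ.1, fun t => ?_⟩, fun t ht => ?_, fun t => ⟨f t, hlt t, rfl⟩⟩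
  · have := hρ.2 (f t)
    dsimp only
    rw [hf]
    split_ifs with h
    · rwa [h, hcyc] at this
    · exact this
  · dsimp only
    rw [heq t ht]

/-- An initial part of a play which is secure within a sufficiently long finite horizon can be
turned into the outcome of a secure equilibrium. -/
lemma exists_deterred_of_follows [Fintype V] {G : QRGame ι V} {v₀ : V} {s : List V → V}
    {ρ : ℕ → V} {c : ι → ℕ∞} {d D : ℕ} (hs : G.IsMove v₀ s) (hρ : G.IsPlay v₀ ρ)
    (hρs : ∀ m, ρ (m + 1) = s (pre ρ m)) (hc : ∀ i, G.costLT i ρ (d + 1) = c i)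
    (hcD : ∀ i, c i ≠ ⊤ → c i < D) (hd : D + 2 * Fintype.card V ≤ d)
    (hsec : ∀ j π, G.IsPlay v₀ π → G.Follows s j d π →
      ¬ Prec j c fun i => G.costLT i π (d + 1))
    (hdev : ∀ j π, G.IsPlay v₀ π → G.Follows s j d π → ¬ Prec j c fun i => G.costLT i π D) :
    ∃ ρ', G.IsPlay v₀ ρ' ∧ (∀ i, G.cost i ρ' = c i) ∧
      G.Deterred v₀ ρ' fun j π => ¬ Prec j (fun i => G.cost i ρ') fun i => G.cost i π := by
  have hV : 0 < Fintype.card V := Fintype.card_pos_iff.2 ⟨v₀⟩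
  have havoid : ∀ j, c j = ⊤ → ∀ π k, G.IsPlay v₀ π → G.Follows s j k π →
      k + (Fintype.card V - 1) ≤ d →
      π k ∉ G.attr {x | G.owner x = j} Set.univ (G.F j) (Fintype.card V - 1) := by
    intro j hj π k hπ hk hkd
    refine hk.notMem_attr hs (fun π hπ hf => ?_) hπ hkd
    by_contra hne
    exact hsec j π hπ hf (Or.inl (hj ▸ lt_top_iff_ne_top.2 hne))
  obtain ⟨a, b, hDa, hab, hb, hcyc⟩ := exists_repetition ρ D
  obtain ⟨ρ', hρ', hlt, hper⟩ := hρ.exists_lasso hab hcyc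
  have hcost : ∀ i, G.cost i ρ' = c i := by
    intro i
    by_cases hi : c i = ⊤
    · rw [hi, cost_eq_top_iff]
      intro t
      obtain ⟨t', ht', h⟩ := hper t
      rw [h]
      exact notMem_of_costLT_eq_top ((hc i).trans hi) (by omega)
    · have h1 : G.cost i ρ = c i := hc i ▸ cost_eq_of_costLT_ne_top (by rwa [hc i])
      rw [← h1]
      exact cost_eq_of_agree (fun m hm => (hlt m (by omega)).symm) (h1 ▸ (hcD i hi).le)
  refine ⟨ρ', hρ', hcost, fun l v hE hne => ?_⟩
  simp only [hcost]
  set j := G.owner (ρ' l) with hj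
  set A := G.attr {x | G.owner x = j} Set.univ (G.F j) (Fintype.card V - 1) with hA
  have hq : ∀ x, ∃ w, G.E x w ∧ (x ∉ A → G.owner x ≠ j → w ∉ A) := by
    intro x
    by_cases hx : x ∉ A ∧ G.owner x ≠ j
    · obtain ⟨w, hw, hwA⟩ := (QRGame.notMem_attr (Set.mem_univ x) hx.1).2 hx.2
      exact ⟨w, hw, fun _ _ => hwA⟩
    · exact (G.total x).imp fun w hw => ⟨hw, fun h1 h2 => absurd ⟨h1, h2⟩ hx⟩
  choose q hqE hqA using hq
  refine ⟨fun h => if h.length ≤ D then s h else q (cur v₀ h), fun h => ?_, fun π hπ => ?_⟩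
  · dsimp only
    split_ifs
    · exact hs h
    · exact hqE _
  obtain ⟨hplay, hagree, -, -⟩ := hπ 0
  have hτ : ∀ m, l < m → G.owner (π m) ≠ j →
      π (m + 1) = if m + 1 ≤ D then s (pre π m) else q (π m) := by
    intro m hlm hm
    simpa using (hπ (m + 1)).2.2.2 m hlm (by omega) hm
  have howner : G.owner (π l) = j := by rw [hagree l le_rfl]
  have hfollow : l < D → G.Follows s j D π := by
    intro hlD m hm hmj
    rcases lt_trichotomy m l with h | rfl | h
    · have hle : ∀ t ≤ l, π t = ρ t := fun t ht => (hagree t ht).trans (hlt t (by omega))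
      rw [hle (m + 1) h, hρs, pre_congr fun t ht => hle t (by omega)]
    · exact absurd howner hmj
    · rw [hτ m h hmj, if_pos (by omega)]
  have htop : c j = ⊤ → G.cost j π = ⊤ := by
    intro hcj
    have hbase : ∀ k ≤ max l D, π k ∉ A := by
      intro k hk
      rcases Nat.lt_or_ge l D with hlD | hlD
      · exact havoid j hcj π k hplay ((hfollow hlD).mono (by omega)) (by omega)
      · obtain ⟨t', ht', h⟩ := hper k
        rw [hagree k (by omega), h]
        exact havoid j hcj ρ t' hρ (fun m _ _ => hρs m) (by omega)
    have hall : ∀ k, π k ∉ A := by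
      intro k
      rcases le_or_gt k (max l D) with hk | hk
      · exact hbase k hk
      · induction k, hk.le using Nat.le_induction with
        | base => exact hbase _ le_rfl
        | succ k hk' ih =>
          have hkA : π k ∉ A := by
            rcases hk'.eq_or_lt with h | h
            · exact hbase k h.ge
            · exact ih h
          by_cases hkj : G.owner (π k) = j
          · exact (QRGame.notMem_attr (Set.mem_univ _) hkA).1 hkj _ (hplay.2 k)
          · have hlk : l ≠ k := by
              rintro rfl
              exact hkj howner
            rw [hτ k (by omega) hkj, if_neg (by omega)]
            exact hqA _ hkA hkj
    exact cost_eq_top_iff.2 fun k hk => hall k (G.subset_attr _ _ _ _ hk)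
  rcases Nat.lt_or_ge l D with hlD | hlD
  · obtain ⟨π', h1, h2, h3, -⟩ := (hfollow hlD).exists_extend hplay hs (fun _ _ => rfl) d
    have hcongr : ∀ i, G.costLT i π' D = G.costLT i π D := fun i =>
      costLT_congr fun t ht => h2 t (by omega)
    have hprec := hdev j π' h1 h3
    simp only [hcongr] at hprec
    refine mt (fun h => ?_) hprec
    rcases h with h | ⟨heq, hall, i, hi⟩
    · left
      dsimp only at h
      have hcj : c j ≠ ⊤ := fun hcj => by
        rw [htop hcj, hcj] at h
        exact lt_irrefl _ h
      exact (costLT_eq_cost (h.trans (hcD j hcj))).trans_lt h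
    · refine Or.inr ⟨?_, fun i => (hall i).trans (cost_le_costLT G i π D), i,
        lt_of_lt_of_le hi (cost_le_costLT G i π D)⟩
      dsimp only at heq ⊢
      by_cases hcj : c j = ⊤
      · rw [hcj, costLT_eq_top (by simp [htop hcj])]
      · rw [costLT_eq_cost (heq ▸ hcD j hcj), heq]
  · have hfin : ∀ i, c i ≠ ⊤ → G.cost i π = c i := by
      intro i hi
      rw [← hcost i]
      exact cost_eq_of_agree (fun m hm => (hagree m (by omega)).symm) (hcost i ▸ (hcD i hi).le)
    rintro (h | ⟨-, -, i, hi⟩)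
    · dsimp only at h
      by_cases hcj : c j = ⊤
      · rw [htop hcj, hcj] at h
        exact lt_irrefl _ h
      · rw [hfin j hcj] at h
        exact lt_irrefl _ h
    · dsimp only at hi
      rw [hfin i hi.ne_top] at hi
      exact lt_irrefl _ hi

/-- A secure equilibrium of the truncated game which is also secure within an earlier horizon `D`
gives rise to a secure equilibrium with the same costs. -/
lemma exists_isSecure_of_trunc [Fintype V] [DecidableEq ι] {G : QRGame ι V} {v₀ : V}
    {σ : ι → List V → V} {d D : ℕ} (hσ : ∀ i, G.IsStratTrunc v₀ d i (σ i))
    (hcD : ∀ i, G.costLT i (G.outcome v₀ σ) (d + 1) ≠ ⊤ →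
      G.costLT i (G.outcome v₀ σ) (d + 1) < D)
    (hd : D + 2 * Fintype.card V ≤ d) (hsec : G.IsSecureTrunc v₀ d σ)
    (hdev : ∀ j σ', G.IsStratTrunc v₀ d j σ' →
      ¬ Prec j (fun i => G.costLT i (G.outcome v₀ σ) D)
        fun i => G.costLT i (G.outcome v₀ (Function.update σ j σ')) D) :
    ∃ σ' : ι → List V → V, G.IsProfile v₀ σ' ∧ G.IsSecure v₀ σ' ∧
      ∀ i, G.cost i (G.outcome v₀ σ') = G.costLT i (G.outcome v₀ σ) (d + 1) := by
  let s : List V → V := G.legalize v₀ fun h => σ (G.owner (cur v₀ h)) h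
  have hs : G.IsMove v₀ s := G.isMove_legalize v₀ _
  have hsσ : ∀ π m, G.IsPlay v₀ π → m < d → s (pre π m) = σ (G.owner (π m)) (pre π m) := by
    intro π m hπ hm
    simp only [s]
    rw [legalize_eq] <;> rw [cur_pre]
    simpa using hσ _ (pre π m) (isHist_pre hπ.1 fun m _ => hπ.2 m) (by simpa using hm) (by simp)
  obtain ⟨ρ, h0, hρs⟩ := exists_seq_of_step s v₀
  have hρ : G.IsPlay v₀ ρ := ⟨h0, fun m => by simpa [hρs m] using hs (pre ρ m)⟩
  have hout : ∀ k ≤ d, G.outcome v₀ σ k = ρ k :=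
    outcome_eq_of_le h0 fun m hm => (hρs m).trans (hsσ ρ m hρ hm)
  have hcD' : ∀ i, G.costLT i (G.outcome v₀ σ) D = G.costLT i (G.outcome v₀ σ) (d + 1) := by
    intro i
    by_cases hi : G.costLT i (G.outcome v₀ σ) (d + 1) = ⊤
    · rw [hi]
      by_contra hne
      obtain ⟨l, hl, -, hF⟩ := costLT_lt_iff.1 (lt_top_iff_ne_top.2 hne)
      exact notMem_of_costLT_eq_top hi (show l < d + 1 by omega) hF
    · have h := hcD i hi
      rw [← cost_eq_of_costLT_ne_top hi] at h ⊢
      exact costLT_eq_cost h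
  have hfollow : ∀ j π, G.IsPlay v₀ π → G.Follows s j d π → ∃ σ', G.IsStratTrunc v₀ d j σ' ∧
      ∀ k ≤ d, G.outcome v₀ (Function.update σ j σ') k = π k := by
    intro j π hπ hf
    obtain ⟨σ', hσ', h⟩ := hπ.exists_deviation (σ := σ) (j := j)
    exact ⟨σ', fun h _ _ _ => hσ' h, h d fun m hm hj => (hf m hm hj).trans (hsσ π m hπ hm)⟩
  obtain ⟨ρ', hρ', hcost, hdet⟩ := exists_deterred_of_follows hs hρ hρs
    (fun i => costLT_congr fun l hl => (hout l (by omega)).symm) hcD hd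
    (fun j π hπ hf hprec => by
      obtain ⟨σ', hσ', h⟩ := hfollow j π hπ hf
      refine hsec ⟨j, σ', hσ', ?_⟩
      have : ∀ i, G.costLT i π (d + 1) =
          G.costLT i (G.outcome v₀ (Function.update σ j σ')) (d + 1) :=
        fun i => costLT_congr fun l hl => (h l (by omega)).symm
      simp only [this] at hprec
      exact hprec)
    (fun j π hπ hf hprec => by
      obtain ⟨σ', hσ', h⟩ := hfollow j π hπ hf
      refine hdev j σ' hσ' ?_
      have : ∀ i, G.costLT i π D = G.costLT i (G.outcome v₀ (Function.update σ j σ')) D :=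
        fun i => costLT_congr fun l hl => (h l (by omega)).symm
      simp only [this, ← hcD'] at hprec
      exact hprec)
  obtain ⟨σ', hσ', hout', hP⟩ := hdet.exists_profile hρ' fun j => by simp [Prec]
  refine ⟨σ', hσ', (isSecure_iff hσ').2 ?_, fun i => by rw [hout', hcost]⟩
  rwa [hout']

end QRGame

lemma enatToWithTopReal_mono : Monotone enatToWithTopReal := by
  intro x y h
  unfold enatToWithTopReal
  by_cases hy : y = ⊤
  · simp [hy]
  · rw [if_neg hy, if_neg (ne_top_of_le_ne_top hy h)]
    exact_mod_cast ENat.toNat_le_toNat h hy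

/-- Let `Γ = 2·|Π|·|V|` and `d = Γ + 3·|V|`, and let `(t_i) ∈ (ℝ ∪ {+∞})^Π` be
thresholds.  There exists a secure equilibrium in `(G, v₀)` whose cost profile
is bounded above by `(t_i)` iff there exists a goal-optimal and dev-optimal
secure equilibrium in the truncated game `𝒯^d` whose cost profile is bounded
above by `(t_i)`. -/
theorem secure_equilibrium_with_thresholds_iff_truncated
    {ι V : Type} [Fintype ι] [Fintype V] [DecidableEq ι]
    (G : QRGame ι V) (v₀ : V) (Γ d : ℕ)
    (hΓ : Γ = 2 * Fintype.card ι * Fintype.card V)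
    (hd : d = Γ + 3 * Fintype.card V)
    (t : ι → WithTop ℝ) :
    (∃ σ : ι → List V → V, G.IsProfile v₀ σ ∧ G.IsSecure v₀ σ ∧
        ∀ i, enatToWithTopReal (G.cost i (G.outcome v₀ σ)) ≤ t i) ↔
      (∃ σ : ι → List V → V, (∀ i, G.IsStratTrunc v₀ d i (σ i)) ∧
        G.IsSecureTrunc v₀ d σ ∧ G.GoalOptTrunc v₀ d σ Γ ∧ G.DevOptTrunc v₀ d σ ∧
        ∀ i, enatToWithTopReal (G.costLT i (G.outcome v₀ σ) (d + 1)) ≤ t i) := by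
  have hV : 0 < Fintype.card V := Fintype.card_pos_iff.2 ⟨v₀⟩
  have hι : 0 < Fintype.card ι := Fintype.card_pos_iff.2 ⟨G.owner v₀⟩
  have hΓ0 : 0 < Γ := by rw [hΓ]; positivity
  constructor
  · rintro ⟨σ, hσ, hsec, ht⟩
    obtain ⟨ρ, hρ, hdet, hle, hgap⟩ := (QRGame.Deterred.of_consistent hσ
      ((QRGame.isSecure_iff hσ).1 hsec)).exists_short_gaps (QRGame.IsPlay.outcome hσ)
    obtain ⟨σ', h1, h2, h3, h4, h5⟩ := hdet.exists_trunc hρ hΓ0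
      (fun i hi => by
        rw [hΓ, mul_right_comm]
        exact QRGame.lt_of_short_gaps (by omega) hgap hi)
      (show Γ + Fintype.card V ≤ d by omega)
    refine ⟨σ', h1, h2, h3, h4, fun i => ?_⟩
    rw [h5]
    exact (enatToWithTopReal_mono (hle i)).trans (ht i)
  · rintro ⟨σ, hσ, hsec, hgoal, hdev, ht⟩
    obtain ⟨M, hM, hM1, hM2⟩ := G.exists_devBoundTrunc_eq v₀ d σ
    have hMΓ : M < Γ := by
      rcases hM2 with rfl | ⟨i, hi⟩
      · exact hΓ0
      · have := hgoal i (by simp [hi])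
        rw [hi] at this
        exact_mod_cast this
    obtain ⟨σ', h1, h2, h3⟩ := QRGame.exists_isSecure_of_trunc (D := M + Fintype.card V) hσ
      (fun i hi => (hM1 i hi).trans_lt (by exact_mod_cast (by omega))) (by omega) hsec
      (hM ▸ hdev)
    exact ⟨σ', h1, h2, fun i => by rw [h3]; exact ht i⟩
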